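/- arXiv:1112.2843 — 10 statements merged into one kernel-verified Lean document; each statement's English description precedes it below -/
import Mathlib

section
/- Suppose Γ is even (S(x, x) ∈ 2ℤ for all x ∈ Γ). Then 4 divides g, and the number of ī-invariant quadratic forms q ∈ 𝒬_e^{(i)} satisfying ∑_{α ∈ A_i} i^{Q_q(α)} = −2^{g/2}·e^{−iπg/4} in ℂ (equivalently: the Brown invariant of Q_q is ≡ 4 − g mod 8; these q correspond exactly to the i-invariant theta divisors Θ with multiplicity m₀(Θ) ≡ 2 mod 4 at the origin, i.e. to vanishing thetanulls of the principally polarized abelian variety A_Γ) equals 2^{g/2 − 1}·(2^{g/2} − (−1)^{g/4}). -/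
/-- The embedding `F₂ ≅ 2ℤ/4ℤ ⊂ ℤ/4ℤ`. -/
def emb2 (t : ZMod 2) : ZMod 4 := 2 * t.val

/-- `i^c ∈ ℂ` for `c ∈ ℤ/4ℤ` (equal to `i^n` for any representative `n` of `c`). -/
noncomputable def iPow (c : ZMod 4) : ℂ := Complex.I ^ c.val

/-- The set of quadratic forms (with values in `ℤ/4ℤ`) associated to a symmetric
`F₂`-bilinear form `β`. -/
def QuadSet {V : Type*} [Add V] (β : V → V → ZMod 2) : Set (V → ZMod 4) :=
  {q | ∀ x y, q (x + y) = q x + q y + emb2 (β x y)}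

/-- `ε := id + ī`, an `F₂`-linear endomorphism of `A₂`. -/
def eps {A : Type*} [AddCommGroup A] [Module (ZMod 2) A]
    (Ibar : A →ₗ[ZMod 2] A) : A →ₗ[ZMod 2] A :=
  LinearMap.id + Ibar

/-- `A_i := ε(A₂)`. -/
def Asub {A : Type*} [AddCommGroup A] [Module (ZMod 2) A]
    (Ibar : A →ₗ[ZMod 2] A) : Submodule (ZMod 2) A :=
  LinearMap.range (eps Ibar)

/-- `εα`, as an element of `A_i`. -/
def epsEl {A : Type*} [AddCommGroup A] [Module (ZMod 2) A]
    (Ibar : A →ₗ[ZMod 2] A) (α : A) : ↥(Asub Ibar) :=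
  ⟨eps Ibar α, LinearMap.mem_range_self _ α⟩



lemma aux_emb2_add (a b : ZMod 2) : emb2 (a + b) = emb2 a + emb2 b := by
  revert a b; decide

lemma aux_iPow_add (a b : ZMod 4) : iPow (a + b) = iPow a * iPow b := by
  unfold iPow
  rw [← pow_add, ZMod.val_add]
  exact (pow_eq_pow_mod (a.val + b.val) Complex.I_pow_four).symm

lemma aux_iPow_emb2 (a : ZMod 2) : iPow (emb2 a) = if a = 0 then 1 else -1 := by
  have h : ∀ a : ZMod 2, (emb2 a).val = if a = 0 then 0 else 2 := by decide
  rw [iPow, h]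
  split_ifs <;> simp

/-- orthogonality -/
lemma aux_orth {W : Type*} [AddCommGroup W] [Module (ZMod 2) W] [Fintype W]
    (l : W →ₗ[ZMod 2] ZMod 2) :
    (∑ u, iPow (emb2 (l u)) = if l = 0 then (Fintype.card W : ℂ) else 0) := by
  split_ifs with h
  · subst h
    simp [aux_iPow_emb2]
  · obtain ⟨v, hv⟩ : ∃ v, l v ≠ 0 := by
      by_contra! hc
      exact h (LinearMap.ext hc)
    have h1 : ∑ u, iPow (emb2 (l u)) = ∑ u, iPow (emb2 (l (u + v))) :=
      (Equiv.sum_comp (Equiv.addRight v) (fun u => iPow (emb2 (l u)))).symm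
    have h2 : ∑ u, iPow (emb2 (l (u + v))) = - ∑ u, iPow (emb2 (l u)) := by
      rw [← Finset.sum_neg_distrib]
      refine Finset.sum_congr rfl fun u _ => ?_
      rw [map_add, aux_emb2_add, aux_iPow_add, aux_iPow_emb2 (l v), if_neg hv]
      ring
    rw [h2] at h1
    linear_combination h1 / 2

lemma aux_exists_half {W : Type*} [AddCommGroup W] [Module (ZMod 2) W] [Finite W]
    (b : W →ₗ[ZMod 2] W →ₗ[ZMod 2] ZMod 2) (halt : ∀ u, b u u = 0) :
    ∃ f : W → ZMod 4, f ∈ QuadSet (fun x y => b x y) := by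
  classical
  have hsymm : ∀ u v, b u v = b v u := by
    intro u v
    have h := halt (u + v)
    simp only [map_add, LinearMap.add_apply, halt, zero_add, add_zero] at h
    generalize b u v = s at h ⊢
    generalize b v u = t at h ⊢
    revert s t; decide
  haveI : Module.Finite (ZMod 2) W := Module.Finite.of_finite
  let β := Module.finBasis (ZMod 2) W
  let B : W →ₗ[ZMod 2] W →ₗ[ZMod 2] ZMod 2 :=
    β.constr ℕ (fun i => β.constr ℕ (fun j => if i < j then b (β i) (β j) else 0))
  have hB : B + B.flip = b := by
    refine β.ext fun i => β.ext fun j => ?_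
    simp only [LinearMap.add_apply, LinearMap.flip_apply, B, Module.Basis.constr_basis]
    rcases lt_trichotomy i j with h | h | h
    · rw [if_pos h, if_neg h.not_gt, add_zero]
    · subst h; simp [halt]
    · rw [if_pos h, if_neg h.not_gt, zero_add, hsymm]
  refine ⟨fun u => emb2 (B u u), fun x y => ?_⟩
  simp only [← aux_emb2_add, map_add, LinearMap.add_apply]
  congr 1
  rw [← hB]
  simp only [LinearMap.add_apply, LinearMap.flip_apply]
  ring

section
variable {W : Type*} [AddCommGroup W] [Module (ZMod 2) W]
    {b : W →ₗ[ZMod 2] W →ₗ[ZMod 2] ZMod 2}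

lemma aux_q_zero {f : W → ZMod 4} (hf : f ∈ QuadSet (fun x y => b x y)) : f 0 = 0 := by
  have := hf 0 0
  simp [emb2] at this
  exact this

lemma aux_q_two (halt : ∀ u, b u u = 0) {f : W → ZMod 4}
    (hf : f ∈ QuadSet (fun x y => b x y)) (u : W) : f u + f u = 0 := by
  have := hf u u
  have h2 : u + u = 0 := by rw [← two_smul (ZMod 2) u]; exact zero_smul (ZMod 2) u
  rw [h2, aux_q_zero hf] at this
  simp [halt, emb2] at this
  exact this.symm

lemma aux_gauss_sq [Fintype W] (halt : ∀ u, b u u = 0)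
    (hnd : ∀ u, (∀ v, b u v = 0) → u = 0) {f : W → ZMod 4}
    (hf : f ∈ QuadSet (fun x y => b x y)) :
    (∑ u, iPow (f u)) ^ 2 = (Fintype.card W : ℂ) := by
  classical
  have hsymm : ∀ u v, b u v = b v u := by
    intro u v
    have h := halt (u + v)
    simp only [map_add, LinearMap.add_apply, halt, zero_add, add_zero] at h
    generalize b u v = s at h ⊢
    generalize b v u = t at h ⊢
    revert s t; decide
  calc (∑ u, iPow (f u)) ^ 2 = ∑ u, ∑ v, iPow (f u) * iPow (f v) := by
        rw [sq, Finset.sum_mul_sum]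
    _ = ∑ u, ∑ w, iPow (f u) * iPow (f (w + u)) := by
        refine Finset.sum_congr rfl fun u _ => ?_
        exact (Equiv.sum_comp (Equiv.addRight u) (fun v => iPow (f u) * iPow (f v))).symm
    _ = ∑ u, ∑ w, iPow (f w) * iPow (emb2 (b w u)) := by
        refine Finset.sum_congr rfl fun u _ => Finset.sum_congr rfl fun w _ => ?_
        rw [← aux_iPow_add, ← aux_iPow_add, hf w u]
        congr 1
        have := aux_q_two halt hf u
        linear_combination this
    _ = ∑ w, iPow (f w) * ∑ u, iPow (emb2 (b w u)) := by
        rw [Finset.sum_comm]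
        simp only [Finset.mul_sum]
    _ = ∑ w : W, if w = 0 then (Fintype.card W : ℂ) else 0 := by
        classical
        refine Finset.sum_congr rfl fun w _ => ?_
        rw [aux_orth (b w)]
        by_cases h : w = 0
        · subst h
          simp [aux_q_zero hf, iPow]
        · rw [if_neg h, if_neg, mul_zero]
          intro h'
          exact h (hnd w fun v => by rw [h']; rfl)
    _ = (Fintype.card W : ℂ) := by rw [Finset.sum_ite_eq']; simp

lemma aux_param [Fintype W] (halt : ∀ u, b u u = 0)
    (hnd : ∀ u, (∀ v, b u v = 0) → u = 0) {f₀ : W → ZMod 4}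
    (hf₀ : f₀ ∈ QuadSet (fun x y => b x y)) :
    ∃ T : W ≃ {f : W → ZMod 4 // f ∈ QuadSet (fun x y => b x y)},
      ∀ w u, (T w).1 u = f₀ u + emb2 (b w u) := by
  haveI : Module.Finite (ZMod 2) W := Module.Finite.of_finite
  have hbij : Function.Surjective b := by
    have hinj : Function.Injective b := by
      rw [← LinearMap.ker_eq_bot, LinearMap.ker_eq_bot']
      intro m hm
      exact hnd m fun v => by rw [hm]; rfl
    exact (LinearMap.injective_iff_surjective_of_finrank_eq_finrank
      (Subspace.dual_finrank_eq (K := ZMod 2) (V := W)).symm).1 hinj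
  let T : W → {f : W → ZMod 4 // f ∈ QuadSet (fun x y => b x y)} := fun w =>
    ⟨fun u => f₀ u + emb2 (b w u), fun x y => by
      simp only [map_add, aux_emb2_add, hf₀ x y]; ring⟩
  have hT : Function.Bijective T := by
    constructor
    · intro w w' h
      have h1 : ∀ u, emb2 (b w u) = emb2 (b w' u) := fun u => by
        have := congrFun (congrArg Subtype.val h) u
        simpa [T] using this
      have h2 : ∀ s t : ZMod 2, emb2 s = emb2 t → s = t := by decide
      have := hnd (w - w') fun v => by
        rw [map_sub, LinearMap.sub_apply, h2 _ _ (h1 v), sub_self]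
      exact sub_eq_zero.1 this
    · rintro ⟨f, hf⟩
      have key : ∀ u, ∃ t : ZMod 2, f u = f₀ u + emb2 t := by
        intro u
        have h1 := aux_q_two halt hf u
        have h2 := aux_q_two halt hf₀ u
        generalize f u = s at h1 ⊢
        generalize f₀ u = s' at h2 ⊢
        revert s s'; decide
      choose l hl using key
      have hl_add : ∀ x y, l (x + y) = l x + l y := by
        intro x y
        have h1 := hf x y
        rw [hl, hl x, hl y, hf₀ x y] at h1
        have h2 : ∀ s t : ZMod 2, emb2 s = emb2 t → s = t := by decide
        apply h2
        rw [aux_emb2_add]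
        linear_combination h1
      let L : W →+ ZMod 2 := AddMonoidHom.mk' l hl_add
      obtain ⟨w, hw⟩ := hbij (L.toZModLinearMap 2)
      refine ⟨w, Subtype.ext (funext fun u => ?_)⟩
      simp only [T, hw, hl u]
      rfl
  exact ⟨Equiv.ofBijective T hT, fun w u => rfl⟩

lemma aux_count [Fintype W] (halt : ∀ u, b u u = 0)
    (hnd : ∀ u, (∀ v, b u v = 0) → u = 0) (m : ℕ) (hm : 1 ≤ m)
    (hcard : Fintype.card W = 2 ^ (2 * m)) (s : ℤ) (hs : s = 1 ∨ s = -1) :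
    (Nat.card {f : W → ZMod 4 // f ∈ QuadSet (fun x y => b x y) ∧
      ∑ u, iPow (f u) = (s : ℂ) * 2 ^ m} : ℤ) = 2 ^ (m - 1) * (2 ^ m + s) := by
  classical
  obtain ⟨f₀, hf₀⟩ := aux_exists_half b halt
  obtain ⟨T, hT⟩ := aux_param halt hnd hf₀
  let G : W → ℂ := fun w => ∑ u, iPow ((T w).1 u)
  have hG : ∀ w, G w = 2 ^ m ∨ G w = - 2 ^ m := by
    intro w
    have := aux_gauss_sq halt hnd (T w).2
    rw [hcard] at this
    apply sq_eq_sq_iff_eq_or_eq_neg.1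
    rw [show G w = _ from rfl, this]
    push_cast
    ring
  have hsum : ∑ w, G w = 2 ^ (2 * m) := by
    simp only [G, hT]
    rw [Finset.sum_comm]
    have : ∀ u : W, ∑ w, iPow (f₀ u + emb2 (b w u)) =
        if u = 0 then ((2 : ℂ) ^ (2 * m)) else 0 := by
      intro u
      simp only [aux_iPow_add, ← Finset.mul_sum]
      have h := aux_orth (b.flip u)
      simp only [LinearMap.flip_apply] at h
      rw [h]
      by_cases hu : u = 0
      · subst hu
        simp [aux_q_zero hf₀, iPow, hcard]
      · rw [if_neg hu, if_neg, mul_zero]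
        intro h'
        apply hu
        apply hnd
        intro v
        have h1 : b v u = 0 := by
          have := LinearMap.congr_fun h' v
          simpa using this
        have h2 := halt (u + v)
        simpa only [map_add, LinearMap.add_apply, halt, zero_add, add_zero, h1] using h2
    simp [this]
  have hN : Nat.card {f : W → ZMod 4 // f ∈ QuadSet (fun x y => b x y) ∧
      ∑ u, iPow (f u) = (s : ℂ) * 2 ^ m} =
      (Finset.univ.filter fun w => G w = (s : ℂ) * 2 ^ m).card := by
    rw [← Fintype.card_subtype, ← Nat.card_eq_fintype_card]
    refine Nat.card_congr ?_
    refine (Equiv.subtypeSubtypeEquivSubtypeInter _ _).symm.trans ?_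
    refine (Equiv.subtypeEquiv T fun w => ?_).symm
    rfl
  rw [hN]
  have hs2 : (s : ℂ) * s = 1 := by rcases hs with rfl | rfl <;> norm_num
  have h2 : ((2 : ℂ) ^ m) ≠ 0 := pow_ne_zero _ two_ne_zero
  have hind : ∀ w, (if G w = (s : ℂ) * 2 ^ m then (2 : ℂ) else 0) * 2 ^ m = 2 ^ m + s * G w := by
    intro w
    have h3 : (2 : ℂ) ^ m ≠ - 2 ^ m := by
      intro h; apply h2; linear_combination h / 2
    rcases hs with rfl | rfl <;> rcases hG w with h | h <;> rw [h]
    · norm_num; ring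
    · rw [if_neg]; · norm_num
      · push_cast; rw [one_mul]; exact h3.symm
    · rw [if_neg]; · norm_num
      · push_cast; rw [neg_one_mul]; exact h3
    · norm_num; ring
  have htot := Finset.sum_congr (rfl : (Finset.univ : Finset W) = Finset.univ)
    (fun w _ => hind w)
  rw [← Finset.sum_mul, Finset.sum_add_distrib, ← Finset.mul_sum, hsum, ← Finset.sum_filter] at htot
  simp only [Finset.sum_const, nsmul_eq_mul, Finset.card_univ, hcard] at htot
  obtain ⟨k, rfl⟩ : ∃ k, m = k + 1 := ⟨m - 1, by omega⟩
  have : (((Finset.univ.filter fun w => G w = (s : ℂ) * 2 ^ (k + 1)).card : ℤ) : ℂ) =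
      ((2 ^ (k + 1 - 1) * (2 ^ (k + 1) + s) : ℤ) : ℂ) := by
    push_cast
    push_cast at htot
    apply mul_right_cancel₀ h2
    linear_combination htot / 2
  exact_mod_cast this
end


abbrev AuxR := QuadraticAlgebra (ZMod 4) (-1) 0

def auxPhi : AuxR →+* ZMod 2 where
  toFun x := (ZMod.castHom (by norm_num : 2 ∣ 4) (ZMod 2)) (x.re + x.im)
  map_one' := by
    rw [QuadraticAlgebra.re_one, QuadraticAlgebra.im_one, add_zero, map_one]
  map_zero' := by
    rw [QuadraticAlgebra.re_zero, QuadraticAlgebra.im_zero, add_zero, map_zero]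
  map_add' x y := by
    rw [QuadraticAlgebra.re_add, QuadraticAlgebra.im_add]
    simp only [map_add]; ring
  map_mul' x y := by
    rcases x with ⟨a, b⟩
    rcases y with ⟨c, d⟩
    simp only [QuadraticAlgebra.re_mul, QuadraticAlgebra.im_mul]
    revert a b c d; decide

/-- the subgroup `{0, 2}` -/
def AuxD (x : AuxR) : Prop := x.re + x.re = 0 ∧ x.im = 0

lemma auxD_star {x : AuxR} (h : AuxD x) : star x = x := by
  ext <;> simp [h.2]

lemma auxD_mul_self {x y : AuxR} (h : AuxD x) (h' : AuxD y) : x * y = 0 := by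
  rcases x with ⟨a, b⟩
  rcases y with ⟨c, d⟩
  simp only [AuxD] at h h'
  ext
  · simp only [QuadraticAlgebra.re_mul, QuadraticAlgebra.re_zero, h.2, h'.2]
    have := h.1; have := h'.1; clear h h'
    revert a c; decide
  · simp [h.2, h'.2]

lemma auxD_phi {x : AuxR} (h : AuxD x) : auxPhi x = 0 := by
  rcases x with ⟨a, b⟩
  obtain ⟨h1, h2⟩ := h
  simp only at h1 h2
  subst h2
  simp only [auxPhi, RingHom.coe_mk, MonoidHom.coe_mk, OneHom.coe_mk]
  revert a; decide

lemma auxD_add {x y : AuxR} (h : AuxD x) (h' : AuxD y) : AuxD (x + y) := by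
  refine ⟨?_, by simp [h.2, h'.2]⟩
  simp only [QuadraticAlgebra.re_add]
  linear_combination h.1 + h'.1

lemma auxD_trace (x : AuxR) : AuxD (x + star x) := by
  refine ⟨?_, by simp⟩
  simp only [QuadraticAlgebra.re_add, QuadraticAlgebra.re_star]
  generalize x.re = a
  generalize x.im = b
  revert a b; decide

lemma auxD_norm {x : AuxR} (h : AuxD x) (y : AuxR) : AuxD (star y * x * y) := by
  rcases x with ⟨a, b⟩
  rcases y with ⟨c, d⟩
  obtain ⟨h1, h2⟩ := h
  simp only at h1 h2
  subst h2
  constructor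
  · simp only [QuadraticAlgebra.re_mul, QuadraticAlgebra.im_mul, QuadraticAlgebra.re_star,
      QuadraticAlgebra.im_star]
    revert a c d; decide
  · simp only [QuadraticAlgebra.re_mul, QuadraticAlgebra.im_mul, QuadraticAlgebra.re_star,
      QuadraticAlgebra.im_star]
    ring

lemma aux_unit {x : AuxR} (h : auxPhi x ≠ 0) : star x * x = 1 := by
  rcases x with ⟨a, b⟩
  simp only [auxPhi, RingHom.coe_mk, MonoidHom.coe_mk, OneHom.coe_mk] at h
  ext
  · simp only [QuadraticAlgebra.re_mul, QuadraticAlgebra.im_mul, QuadraticAlgebra.re_star,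
      QuadraticAlgebra.im_star, QuadraticAlgebra.re_one]
    revert a b; decide
  · simp only [QuadraticAlgebra.re_mul, QuadraticAlgebra.im_mul, QuadraticAlgebra.re_star,
      QuadraticAlgebra.im_star, QuadraticAlgebra.im_one]
    ring

open Matrix in
lemma aux_det (n : ℕ) : ∀ (ι : Type) [Fintype ι] [DecidableEq ι] (H : Matrix ι ι AuxR),
    Fintype.card ι = n → (∀ i j, H i j = star (H j i)) → (∀ i, AuxD (H i i)) →
    IsUnit H.det → Even n ∧ H.det = (-1) ^ (n / 2) := by
  induction n using Nat.strong_induction_on with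
  | _ n ih =>
  intro ι _ _ H hn hH hD hu
  by_cases h0 : n = 0
  · subst h0
    haveI := Fintype.card_eq_zero_iff.1 hn
    simp
  obtain ⟨i₀⟩ : Nonempty ι := Fintype.card_pos_iff.1 (by omega)
  obtain ⟨j₀, hj⟩ : ∃ j, auxPhi (H i₀ j) ≠ 0 := by
    by_contra! hc
    have h1 : auxPhi H.det = 0 := by
      rw [RingHom.map_det]
      exact Matrix.det_eq_zero_of_row_eq_zero i₀ hc
    exact (hu.map auxPhi).ne_zero h1
  have hij : i₀ ≠ j₀ := by
    rintro rfl
    exact hj (auxD_phi (hD _))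
  let κ := {k : ι // k ≠ i₀ ∧ k ≠ j₀}
  let F : Fin 2 ⊕ κ → ι := Sum.elim ![i₀, j₀] Subtype.val
  have hF : Function.Bijective F := by
    constructor
    · rintro (a | a) (c | c) h
      · fin_cases a <;> fin_cases c
        · rfl
        · exact absurd h hij
        · exact absurd h.symm hij
        · rfl
      · exfalso
        obtain ⟨c, hc1, hc2⟩ := c
        fin_cases a
        · exact hc1 h.symm
        · exact hc2 h.symm
      · exfalso
        obtain ⟨a, hc1, hc2⟩ := a
        fin_cases c
        · exact hc1 h
        · exact hc2 h
      · exact congrArg Sum.inr (Subtype.ext h)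
    · intro k
      by_cases h1 : k = i₀
      · exact ⟨Sum.inl 0, h1.symm⟩
      by_cases h2 : k = j₀
      · exact ⟨Sum.inl 1, h2.symm⟩
      exact ⟨Sum.inr ⟨k, h1, h2⟩, rfl⟩
  let E := Equiv.ofBijective F hF
  have hcard : n = 2 + Fintype.card κ := by
    rw [← hn, ← Fintype.card_congr E]; simp
  have hdet : (H.submatrix E E).det = H.det := Matrix.det_submatrix_equiv_self E H
  set a := H i₀ i₀ with ha
  set c := H j₀ j₀ with hc
  set u := H i₀ j₀ with hu'
  have hus : H j₀ i₀ = star u := hH _ _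
  have huu : star u * u = 1 := aux_unit hj
  have hac : a * c = 0 := auxD_mul_self (hD _) (hD _)
  let A : Matrix (Fin 2) (Fin 2) AuxR := !![a, u; star u, c]
  let A' : Matrix (Fin 2) (Fin 2) AuxR := !![-c, u; star u, -a]
  have hAA : A * A' = 1 := by
    refine Matrix.ext fun i j => ?_
    fin_cases i <;> fin_cases j <;> simp [A, A', Matrix.mul_apply, Fin.sum_univ_two]
    · linear_combination huu - hac
    · ring
    · ring
    · linear_combination huu - hac
  have hA'A : A' * A = 1 := mul_eq_one_comm.1 hAA
  letI : Invertible A := ⟨A', hA'A, hAA⟩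
  let B : Matrix (Fin 2) κ AuxR := fun i k => H (![i₀, j₀] i) k
  let C : Matrix κ (Fin 2) AuxR := fun k i => H k (![i₀, j₀] i)
  let D : Matrix κ κ AuxR := fun k l => H k l
  have hblock : H.submatrix E E = fromBlocks A B C D := by
    refine Matrix.ext fun i j => ?_
    rcases i with i | i <;> rcases j with j | j
    · fin_cases i <;> fin_cases j <;> simp [E, F, A, ha, hc, hu', hus]
    · rfl
    · rfl
    · rfl
  have hdetA : A.det = -1 := by
    simp only [A, Matrix.det_fin_two_of]
    linear_combination hac - huu
  have hdet2 : H.det = - (D - C * A' * B).det := by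
    rw [← hdet, hblock, Matrix.det_fromBlocks₁₁, hdetA, neg_one_mul]
    rfl
  have hentry : ∀ k l, (D - C * A' * B) k l = H k l -
      (-(star (H i₀ k) * c * H i₀ l) + (star (H j₀ k) * star u * H i₀ l) +
        (star (H i₀ k) * u * H j₀ l) - star (H j₀ k) * a * H j₀ l) := by
    intro k l
    have e1 : D k l = H k l := rfl
    have e2 : C k 0 = star (H i₀ k) := hH _ _
    have e3 : C k 1 = star (H j₀ k) := hH _ _
    have e4 : B 0 l = H i₀ l := rfl
    have e5 : B 1 l = H j₀ l := rfl
    have e6 : A' 0 0 = -c := rfl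
    have e7 : A' 0 1 = u := rfl
    have e8 : A' 1 0 = star u := rfl
    have e9 : A' 1 1 = -a := rfl
    simp only [Matrix.sub_apply, Matrix.mul_apply, Fin.sum_univ_two, e1, e2, e3, e4, e5, e6, e7,
      e8, e9]
    ring
  have ihκ := ih (Fintype.card κ) (by omega) κ (D - C * A' * B) rfl ?_ ?_ ?_
  · obtain ⟨h1, h2⟩ := ihκ
    refine ⟨by rw [hcard]; exact even_two.add h1, ?_⟩
    rw [hdet2, h2, hcard, show (2 + Fintype.card κ) / 2 = Fintype.card κ / 2 + 1 by omega]
    ring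
  · intro k l
    rw [hentry, hentry]
    simp only [star_sub, star_add, star_neg, star_mul, star_star, ← hH]
    rw [auxD_star (hD i₀), auxD_star (hD j₀)]
    ring
  · intro k
    rw [hentry]
    have h1 := auxD_trace (-(star (H j₀ k) * star u * H i₀ k))
    have h2 := auxD_norm (hD j₀) (H i₀ k)
    have h3 := auxD_norm (hD i₀) (H j₀ k)
    have h4 := auxD_add (auxD_add (auxD_add (hD k) h1) h2) h3
    convert h4 using 1
    simp only [star_sub, star_add, star_neg, star_mul, star_star]
    simp only [← ha, ← hc]
    ring
  · have := hu.neg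
    rwa [hdet2, neg_neg] at this


lemma aux_floor (x : ℝ) : Filter.Tendsto (fun n : ℕ => (⌊((n : ℝ) + 1) * x⌋ : ℝ) / ((n : ℝ) + 1))
    Filter.atTop (nhds x) := by
  have h0 := tendsto_one_div_add_atTop_nhds_zero_nat (𝕜 := ℝ)
  have h1 : Filter.Tendsto (fun n : ℕ => x - 1 / ((n : ℝ) + 1)) Filter.atTop (nhds x) := by
    simpa using h0.const_sub x
  refine tendsto_of_tendsto_of_tendsto_of_le_of_le h1 tendsto_const_nhds ?_ ?_
  · intro n
    have hn : (0 : ℝ) < (n : ℝ) + 1 := by positivity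
    have := Int.lt_floor_add_one (((n : ℝ) + 1) * x)
    simp only
    rw [le_div_iff₀ hn, sub_mul, one_div, inv_mul_cancel₀ hn.ne']
    linarith
  · intro n
    have hn : (0 : ℝ) < (n : ℝ) + 1 := by positivity
    have := Int.floor_le (((n : ℝ) + 1) * x)
    simp only
    rw [div_le_iff₀ hn]
    linarith

open ComplexOrder Matrix in
lemma aux_psd {ι : Type} [Fintype ι] (H : Matrix ι ι GaussianInt)
    (hH : ∀ i j, H i j = star (H j i))
    (hp : ∀ w : ι → GaussianInt, 0 ≤ (∑ k, ∑ l, star (w k) * H k l * w l).re) :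
    (H.map GaussianInt.toComplex).PosSemidef := by
  have hst : ∀ z : GaussianInt, GaussianInt.toComplex (star z) = star (GaussianInt.toComplex z) :=
    fun z => GaussianInt.toComplex_star z
  have hherm : (H.map GaussianInt.toComplex).IsHermitian := by
    refine Matrix.ext fun i j => ?_
    rw [Matrix.conjTranspose_apply, Matrix.map_apply, Matrix.map_apply, ← hst, ← hH]
  refine PosSemidef.of_dotProduct_mulVec_nonneg hherm fun x => ?_
  have him := hherm.im_star_dotProduct_mulVec_self x
  rw [RCLike.nonneg_iff]
  refine ⟨?_, him⟩
  let F : (ι → ℂ) → ℝ := fun z => (∑ k, ∑ l, star (z k) * GaussianInt.toComplex (H k l) * z l).re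
  have hF : ∀ z : ι → ℂ, F z = (star z ⬝ᵥ (H.map GaussianInt.toComplex) *ᵥ z).re := by
    intro z
    simp only [F, dotProduct, mulVec, Finset.mul_sum, Pi.star_apply, Matrix.map_apply, mul_assoc]
  change 0 ≤ (star x ⬝ᵥ (H.map GaussianInt.toComplex) *ᵥ x).re
  rw [← hF]
  have hcont : Continuous F := by
    simp only [F]
    fun_prop
  let w : ℕ → ι → GaussianInt := fun n k =>
    ⟨⌊((n : ℝ) + 1) * (x k).re⌋, ⌊((n : ℝ) + 1) * (x k).im⌋⟩
  let c : ℕ → ι → ℂ := fun n k => GaussianInt.toComplex (w n k) * (((n : ℝ) + 1)⁻¹ : ℝ)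
  have hc : Filter.Tendsto c Filter.atTop (nhds x) := by
    rw [tendsto_pi_nhds]
    intro k
    have h1 := (Complex.continuous_ofReal.tendsto _).comp (aux_floor (x k).re)
    have h2 := (Complex.continuous_ofReal.tendsto _).comp (aux_floor (x k).im)
    have h3 := h1.add (h2.mul_const Complex.I)
    rw [Complex.re_add_im] at h3
    refine h3.congr fun n => ?_
    simp only [c, w, GaussianInt.toComplex_def, Function.comp_apply]
    push_cast
    ring
  refine ge_of_tendsto' ((hcont.tendsto x).comp hc) fun n => ?_
  have hn : (0 : ℝ) ≤ ((n : ℝ) + 1)⁻¹ := by positivity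
  have key : ∑ k, ∑ l, star (c n k) * GaussianInt.toComplex (H k l) * c n l =
      (((((n : ℝ) + 1)⁻¹ * ((n : ℝ) + 1)⁻¹ : ℝ)) : ℂ) *
        GaussianInt.toComplex (∑ k, ∑ l, star (w n k) * H k l * w n l) := by
    simp only [map_sum, map_mul, hst, Finset.mul_sum, c, star_mul']
    refine Finset.sum_congr rfl fun k _ => Finset.sum_congr rfl fun l _ => ?_
    rw [show star ((((n : ℝ) + 1)⁻¹ : ℝ) : ℂ) = ((((n : ℝ) + 1)⁻¹ : ℝ) : ℂ) from
      Complex.conj_ofReal _]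
    push_cast
    ring
  simp only [Function.comp_apply, F]
  rw [key, Complex.re_ofReal_mul, ← GaussianInt.intCast_re]
  have := hp (w n)
  have h4 : (0 : ℝ) ≤ ((∑ k, ∑ l, star (w n k) * H k l * w n l).re : ℤ) := by exact_mod_cast this
  exact mul_nonneg (mul_nonneg hn hn) h4

def auxPsi : GaussianInt →+* AuxR where
  toFun z := ⟨z.re, z.im⟩
  map_one' := by
    ext
    · rw [QuadraticAlgebra.re_one]; simp
    · rw [QuadraticAlgebra.im_one]; simp
  map_zero' := by ext <;> simp
  map_add' x y := by ext <;> simp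
  map_mul' x y := by ext <;> simp

open Matrix in
lemma aux_herm {ι : Type} [Fintype ι] [DecidableEq ι] (H : Matrix ι ι GaussianInt)
    (hH : ∀ i j, H i j = star (H j i))
    (hp : ∀ w : ι → GaussianInt, 0 ≤ (∑ k, ∑ l, star (w k) * H k l * w l).re)
    (hev : ∀ i, 2 ∣ (H i i).re) (hu : IsUnit H.det) : 4 ∣ Fintype.card ι := by
  have hpsd := aux_psd H hH hp
  have hstar : star H.det = H.det := by
    rw [← Matrix.det_conjTranspose]
    congr 1
    refine Matrix.ext fun i j => ?_
    rw [Matrix.conjTranspose_apply, ← hH]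
  have him : H.det.im = 0 := by
    have := congrArg Zsqrtd.im hstar
    rw [Zsqrtd.im_star] at this
    omega
  have hre : 0 ≤ H.det.re := by
    have h1 := hpsd.det_nonneg
    have h2 : (H.map GaussianInt.toComplex).det = GaussianInt.toComplex H.det :=
      (RingHom.map_det GaussianInt.toComplex H).symm
    rw [h2] at h1
    have h3 := (Complex.nonneg_iff.1 h1).1
    rw [← GaussianInt.intCast_re] at h3
    exact_mod_cast h3
  have hone : H.det = 1 := by
    obtain ⟨v, hv⟩ := hu.exists_right_inv
    have h1 := congrArg Zsqrtd.re hv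
    rw [Zsqrtd.re_mul, him] at h1
    have h2 : H.det.re * v.re = 1 := by simpa using h1
    have h3 : H.det.re = 1 := by
      rcases Int.eq_one_or_neg_one_of_mul_eq_one h2 with h | h <;> omega
    exact Zsqrtd.ext h3 him
  have hdet : (H.map auxPsi).det = 1 := by
    have h2 : (H.map auxPsi).det = auxPsi H.det := (RingHom.map_det auxPsi H).symm
    rw [h2, hone, map_one]
  have := aux_det (Fintype.card ι) ι (H.map auxPsi) rfl ?_ ?_ ?_
  · obtain ⟨h1, h2⟩ := this
    rw [hdet] at h2
    have h3 : Even (Fintype.card ι / 2) := by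
      by_contra hne
      rw [(Nat.not_even_iff_odd.1 hne).neg_one_pow] at h2
      have := congrArg QuadraticAlgebra.re h2
      rw [QuadraticAlgebra.re_neg, QuadraticAlgebra.re_one] at this
      revert this; decide
    obtain ⟨a, ha⟩ := h1
    obtain ⟨c, hc⟩ := h3
    omega
  · intro i j
    rw [Matrix.map_apply, Matrix.map_apply, hH i j]
    ext <;> simp [auxPsi]
  · intro i
    rw [Matrix.map_apply]
    refine ⟨?_, ?_⟩
    · obtain ⟨k, hk⟩ := hev i
      simp only [auxPsi, RingHom.coe_mk, MonoidHom.coe_mk, OneHom.coe_mk, hk]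
      push_cast
      generalize (k : ZMod 4) = t
      revert t; decide
    · have := congrArg Zsqrtd.im (hH i i)
      rw [Zsqrtd.im_star] at this
      have h0 : (H i i).im = 0 := by omega
      simp [auxPsi, h0]
  · rw [hdet]; exact isUnit_one


/-- the Gaussian module structure -/
@[reducible] def auxMod (Γ : Type) [AddCommGroup Γ] (I : Γ ≃ₗ[ℤ] Γ) (hI2 : ∀ x : Γ, I (I x) = -x) :
    Module GaussianInt Γ where
  smul z x := z.re • x + z.im • I x
  one_smul x := by
    change (1 : GaussianInt).re • x + (1 : GaussianInt).im • I x = x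
    simp
  mul_smul z w x := by
    change (z * w).re • x + (z * w).im • I x =
      z.re • (w.re • x + w.im • I x) + z.im • I (w.re • x + w.im • I x)
    simp only [Zsqrtd.re_mul, Zsqrtd.im_mul, map_add, map_zsmul, hI2]
    module
  smul_zero z := by
    change z.re • (0 : Γ) + z.im • I 0 = 0
    simp
  smul_add z x y := by
    change z.re • (x + y) + z.im • I (x + y) = (z.re • x + z.im • I x) + (z.re • y + z.im • I y)
    rw [map_add]; module
  add_smul z w x := by
    change (z + w).re • x + (z + w).im • I x = (z.re • x + z.im • I x) + (w.re • x + w.im • I x)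
    simp only [Zsqrtd.re_add, Zsqrtd.im_add]; module
  zero_smul x := by
    change (0 : GaussianInt).re • x + (0 : GaussianInt).im • I x = 0
    simp

lemma aux_four_dvd (g : ℕ)
    (Γ : Type) [AddCommGroup Γ]
    [Module.Free ℤ Γ] [Module.Finite ℤ Γ]
    (hrank : Module.finrank ℤ Γ = 2 * g)
    (S : Γ →ₗ[ℤ] Γ →ₗ[ℤ] ℤ)
    (hSsymm : ∀ x y : Γ, S x y = S y x)
    (hSpos : ∀ x : Γ, x ≠ 0 → 0 < S x x)
    (I : Γ ≃ₗ[ℤ] Γ)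
    (hI2 : ∀ x : Γ, I (I x) = -x)
    (hSI : ∀ x y : Γ, S (I x) (I y) = S x y)
    (hunimod : Function.Bijective fun x : Γ => S x)
    (heven : ∀ x : Γ, 2 ∣ S x x) : 4 ∣ g := by
  classical
  letI : Module GaussianInt Γ := auxMod Γ I hI2
  have hsm : ∀ (z : GaussianInt) (x : Γ), z • x = z.re • x + z.im • I x := fun _ _ => rfl
  have hSI' : ∀ x y, S x (I y) = - S (I x) y := by
    intro x y
    have := hSI x (I y)
    rw [hI2, map_neg] at this
    linarith
  haveI : Module.Finite GaussianInt Γ := Module.Finite.of_restrictScalars_finite ℤ _ _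
  haveI : Module.IsTorsionFree GaussianInt Γ := by
    apply Module.IsTorsionFree.of_smul_eq_zero
    intro z x hz
    have h1 : (z.re * z.re + z.im * z.im) • x = 0 := by
      have h2 : star z • (z • x) = 0 := by rw [hz, smul_zero]
      rw [smul_smul, hsm] at h2
      simp only [Zsqrtd.re_mul, Zsqrtd.im_mul, Zsqrtd.re_star, Zsqrtd.im_star] at h2
      rw [← h2]
      module
    rcases smul_eq_zero.1 h1 with h | h
    · left
      have ha : z.re = 0 := by nlinarith [sq_nonneg z.re, sq_nonneg z.im]
      have hb : z.im = 0 := by nlinarith [sq_nonneg z.re, sq_nonneg z.im]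
      exact Zsqrtd.ext ha hb
    · exact Or.inr h
  haveI : Module.Free GaussianInt Γ := Module.free_of_finite_type_torsion_free'
  let β := Module.finBasis GaussianInt Γ
  let E2 : GaussianInt ≃ₗ[ℤ] ℤ × ℤ := AddEquiv.toIntLinearEquiv
    { toFun := fun z => (z.re, z.im)
      invFun := fun p => ⟨p.1, p.2⟩
      left_inv := fun z => rfl
      right_inv := fun p => rfl
      map_add' := fun z w => by simp }
  haveI : Module.Free ℤ GaussianInt := Module.Free.of_equiv E2.symm
  have h2 : Module.finrank ℤ GaussianInt = 2 := by
    rw [E2.finrank_eq]; simp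
  have hgr : Module.finrank GaussianInt Γ = g := by
    have := Module.finrank_mul_finrank ℤ GaussianInt Γ
    rw [h2, hrank] at this
    omega
  let h : Γ → Γ →ₗ[GaussianInt] GaussianInt := fun y =>
    { toFun := fun x => ⟨S y x, - S y (I x)⟩
      map_add' := fun x x' => by
        ext <;> simp; ring
      map_smul' := fun z x => by
        ext <;> simp [hsm, hI2] <;> ring }
  have hre : ∀ y x, (h y x).re = S y x := fun _ _ => rfl
  have him : ∀ y x, (h y x).im = - S y (I x) := fun _ _ => rfl
  have hherm : ∀ y x, h y x = star (h x y) := by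
    intro y x
    ext
    · rw [Zsqrtd.re_star, hre, hre, hSsymm]
    · rw [Zsqrtd.im_star, him, him, hSI', hSsymm]
  let H : Matrix (Fin (Module.finrank GaussianInt Γ)) (Fin (Module.finrank GaussianInt Γ))
    GaussianInt := fun k l => h (β k) (β l)
  have hexp : ∀ (c : Fin (Module.finrank GaussianInt Γ) → GaussianInt) (x : Γ),
      h (∑ k, c k • β k) x = ∑ k, star (c k) * h (β k) x := by
    intro c x
    rw [hherm, map_sum, star_sum]
    refine Finset.sum_congr rfl fun k _ => ?_
    rw [map_smul, smul_eq_mul, star_mul', ← hherm]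
  have hH : ∀ k l, H k l = star (H l k) := fun k l => hherm _ _
  have hdvd := aux_herm H hH ?_ ?_ ?_
  · rwa [Fintype.card_fin, hgr] at hdvd
  · intro w
    have : ∑ k, ∑ l, star (w k) * H k l * w l = h (∑ k, w k • β k) (∑ k, w k • β k) := by
      rw [hexp]
      refine Finset.sum_congr rfl fun k _ => ?_
      rw [map_sum, Finset.mul_sum]
      refine Finset.sum_congr rfl fun l _ => ?_
      rw [map_smul, smul_eq_mul]
      change star (w k) * h (β k) (β l) * w l = _
      ring
    rw [this, hre]
    by_cases h0 : (∑ k, w k • β k) = 0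
    · rw [h0]; simp
    · exact (hSpos _ h0).le
  · intro i
    exact heven _
  · have hy : ∀ k, ∃ y : Γ, ∀ x, S y x = (β.repr x k).re := by
      intro k
      let φ : Γ →+ ℤ := AddMonoidHom.mk' (fun x => (β.repr x k).re) (fun a b => by simp)
      obtain ⟨y, hy⟩ := hunimod.2 φ.toIntLinearMap
      exact ⟨y, fun x => by
        have := LinearMap.congr_fun hy x
        exact this⟩
    choose y hy using hy
    have hI : ∀ x, I x = (⟨0, 1⟩ : GaussianInt) • x := by
      intro x; rw [hsm]; simp
    have hy2 : ∀ k x, h (y k) x = β.repr x k := by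
      intro k x
      ext
      · rw [hre, hy]
      · rw [him, hy, hI]; simp
    let P : Matrix (Fin (Module.finrank GaussianInt Γ)) (Fin (Module.finrank GaussianInt Γ))
      GaussianInt := fun k m => star (β.repr (y k) m)
    have hPH : P * H = 1 := by
      refine Matrix.ext fun k l => ?_
      rw [Matrix.mul_apply]
      change ∑ m, star (β.repr (y k) m) * h (β m) (β l) = _
      rw [← hexp, β.sum_repr, hy2, Module.Basis.repr_self, Matrix.one_apply, Finsupp.single_apply]
      simp only [eq_comm]
    have := congrArg Matrix.det hPH
    rw [Matrix.det_mul, Matrix.det_one] at this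
    exact IsUnit.of_mul_eq_one _ (by rw [mul_comm]; exact this)


lemma aux_cardA (n : ℕ) (Γ : Type) [AddCommGroup Γ]
    [Module.Free ℤ Γ] [Module.Finite ℤ Γ]
    (hrank : Module.finrank ℤ Γ = n)
    (A₂ : Type) [AddCommGroup A₂]
    (pr : Γ →+ A₂) (hpr : Function.Surjective pr)
    (hker : ∀ x : Γ, pr x = 0 ↔ ∃ y : Γ, x = 2 • y) : Nat.card A₂ = 2 ^ n := by
  classical
  let β := Module.finBasis ℤ Γ
  let ψ : Γ →+ (Fin (Module.finrank ℤ Γ) → ZMod 2) :=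
    AddMonoidHom.mk' (fun x k => ((β.repr x k : ℤ) : ZMod 2)) (fun a b => by ext k; simp)
  have hψ : ∀ x k, ψ x k = ((β.repr x k : ℤ) : ZMod 2) := fun _ _ => rfl
  have hsurj : Function.Surjective ψ := by
    intro v
    refine ⟨β.equivFun.symm fun k => ((v k).val : ℤ), ?_⟩
    ext k
    rw [hψ]
    have := congrFun (β.equivFun.apply_symm_apply (fun k => ((v k).val : ℤ))) k
    rw [Module.Basis.equivFun_apply] at this
    rw [this]
    simp
  have hk : pr.ker = ψ.ker := by
    ext x
    rw [AddMonoidHom.mem_ker, AddMonoidHom.mem_ker, hker]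
    constructor
    · rintro ⟨y, rfl⟩
      ext k
      rw [hψ, map_nsmul]
      simp only [Finsupp.smul_apply, nsmul_eq_mul, Int.cast_mul]
      have : ((2 : ℕ) : ZMod 2) = 0 := rfl
      simp
      left; rfl
    · intro h
      have h1 : ∀ k, ∃ c, β.repr x k = 2 * c := by
        intro k
        have := congrFun h k
        rw [hψ] at this
        exact (ZMod.intCast_zmod_eq_zero_iff_dvd _ 2).1 this
      choose c hc using h1
      refine ⟨β.equivFun.symm c, ?_⟩
      apply β.equivFun.injective
      rw [map_nsmul, LinearEquiv.apply_symm_apply]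
      ext k
      rw [Module.Basis.equivFun_apply, hc]
      simp
  have e1 := QuotientAddGroup.quotientKerEquivOfSurjective pr hpr
  have e2 := QuotientAddGroup.quotientKerEquivOfSurjective ψ hsurj
  have e3 := QuotientAddGroup.quotientAddEquivOfEq hk
  rw [Nat.card_congr ((e1.symm.trans e3).trans e2).toEquiv, ← hrank]
  simp


/-- Suppose `Γ` is even.  Then `4 ∣ g`, and the number of `ī`-invariant
quadratic forms `q ∈ 𝒬_e^{(i)}` whose Gauss sum `∑_{α ∈ A_i} i^{Q_q(α)}` equals
`−2^{g/2}·e^{−iπg/4}` (equivalently: the Brown invariant of `Q_q` is `≡ 4 − g mod 8`; these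
`q` correspond exactly to the vanishing thetanulls of `A_Γ`) equals
`2^{g/2−1}·(2^{g/2} − (−1)^{g/4})`. -/
theorem statement2 (g : ℕ) (hg : 1 ≤ g)
    (Γ : Type) [AddCommGroup Γ] [Module ℤ Γ]
    [Module.Free ℤ Γ] [Module.Finite ℤ Γ]
    (hrank : Module.finrank ℤ Γ = 2 * g)
    (S : Γ →ₗ[ℤ] Γ →ₗ[ℤ] ℤ)
    (hSsymm : ∀ x y : Γ, S x y = S y x)
    (hSpos : ∀ x : Γ, x ≠ 0 → 0 < S x x)
    (I : Γ ≃ₗ[ℤ] Γ)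
    (hI2 : ∀ x : Γ, I (I x) = -x)
    (hSI : ∀ x y : Γ, S (I x) (I y) = S x y)
    (hunimod : Function.Bijective fun x : Γ => S x)
    (heven : ∀ x : Γ, 2 ∣ S x x)
    (A₂ : Type) [AddCommGroup A₂] [Module (ZMod 2) A₂] [Finite A₂]
    (pr : Γ →+ A₂) (hpr : Function.Surjective pr)
    (hker : ∀ x : Γ, pr x = 0 ↔ ∃ y : Γ, x = 2 • y)
    (Ibar : A₂ →ₗ[ZMod 2] A₂) (hIbar : ∀ x : Γ, Ibar (pr x) = pr (I x))
    (e : A₂ →ₗ[ZMod 2] A₂ →ₗ[ZMod 2] ZMod 2)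
    (he : ∀ x y : Γ, e (pr x) (pr y) = ((S (I x) y : ℤ) : ZMod 2))
    (Q : A₂ → ZMod 4)
    (hQ : ∀ x : Γ, Q (pr x) = ((S x x : ℤ) : ZMod 4))
    -- the map `q ↦ Q_q`, where `Q_q` is determined by `Q_q(εα) = q(α) − Q(α)`
    (Qmap : (A₂ → ZMod 4) → (↥(Asub Ibar) → ZMod 4))
    (hQmap : ∀ q ∈ QuadSet (fun x y => e x y) ∩ {q | ∀ x, q (Ibar x) = q x},
      ∀ α : A₂, Qmap q (epsEl Ibar α) = q α - Q α) :
    4 ∣ g ∧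
    (Nat.card {q : A₂ → ZMod 4 //
        q ∈ QuadSet (fun x y => e x y) ∧ (∀ x, q (Ibar x) = q x) ∧
        ∑ᶠ α : ↥(Asub Ibar), iPow (Qmap q α) =
          -(2 : ℂ) ^ (g / 2) *
            Complex.exp (-((Real.pi * g / 4 : ℝ) : ℂ) * Complex.I)} : ℤ) =
      2 ^ (g / 2 - 1) * (2 ^ (g / 2) - (-1) ^ (g / 4)) := by

  obtain rfl : ‹Module ℤ Γ› = AddCommGroup.toIntModule Γ := Subsingleton.elim _ _
  have h4 : 4 ∣ g := aux_four_dvd g Γ hrank S hSsymm hSpos I hI2 hSI hunimod heven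
  refine ⟨h4, ?_⟩
  classical
  have hcardA := aux_cardA _ Γ hrank A₂ pr hpr hker
  haveI : Module.Finite (ZMod 2) A₂ := Module.Finite.of_finite
  letI : Fintype (Asub Ibar) := Fintype.ofFinite _
  have hchar : ∀ x : A₂, x + x = 0 := fun x => by
    rw [← two_smul (ZMod 2) x]; exact zero_smul (ZMod 2) x
  have heps : ∀ x, eps Ibar x = x + Ibar x := fun _ => rfl
  have hII : ∀ x, Ibar (Ibar x) = x := by
    intro x
    obtain ⟨x, rfl⟩ := hpr x
    rw [hIbar, hIbar, hI2, map_neg]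
    exact neg_eq_of_add_eq_zero_left (hchar _)
  have hsmul2 : ∀ x y : Γ, (2 : ℕ) • x = (2 : ℕ) • y → x = y := by
    intro x y hxy
    have : (2 : ℤ) • (x - y) = 0 := by
      have h : (2 : ℤ) • (x - y) = 2 • x - 2 • y := by module
      rw [h, hxy, sub_self]
    rcases smul_eq_zero.1 this with h | h
    · norm_num at h
    · exact sub_eq_zero.1 h
  have hkr : LinearMap.ker (eps Ibar) = LinearMap.range (eps Ibar) := by
    apply le_antisymm
    · intro a ha
      obtain ⟨x, rfl⟩ := hpr a
      rw [LinearMap.mem_ker, heps, hIbar, ← map_add, hker] at ha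
      obtain ⟨y, hy⟩ := ha
      refine ⟨pr y, ?_⟩
      rw [heps, hIbar, ← map_add, ← sub_eq_zero, ← map_sub, hker]
      refine ⟨I y, ?_⟩
      have h1 : I x - x = 2 • I y := by
        have := congrArg I hy
        rw [map_add, hI2, map_nsmul] at this
        rw [← this]; abel
      have h2 : x = y - I y := by
        apply hsmul2
        rw [smul_sub, ← hy, ← h1]
        module
      rw [h2, map_sub, hI2] at h1
      nth_rewrite 1 [h2]
      abel_nf
    · rintro _ ⟨x, rfl⟩
      rw [LinearMap.mem_ker, heps, heps, map_add, hII]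
      rw [add_comm (Ibar x) x]
      exact hchar _
  have hcardW : Fintype.card (Asub Ibar) = 2 ^ (2 * (g / 2)) := by
    have h1 := LinearMap.finrank_range_add_finrank_ker (eps Ibar)
    rw [hkr] at h1
    have h2 : Module.finrank (ZMod 2) A₂ = 2 * g := by
      have := Module.natCard_eq_pow_finrank (K := ZMod 2) (V := A₂)
      rw [hcardA, Nat.card_zmod] at this
      exact (Nat.pow_right_injective (le_refl 2) this).symm
    rw [Module.card_eq_pow_finrank (K := ZMod 2), ZMod.card]
    have h3 : Module.finrank (ZMod 2) (Asub Ibar) = g := by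
      have : Module.finrank (ZMod 2) (Asub Ibar) =
        Module.finrank (ZMod 2) (LinearMap.range (eps Ibar)) := rfl
      omega
    rw [h3]
    congr 1
    omega
  -- properties of e
  have hSI' : ∀ x y, S x (I y) = - S (I x) y := by
    intro x y
    have := hSI x (I y)
    rw [hI2, map_neg] at this
    linarith
  have heII : ∀ x y, e (Ibar x) y = e x (Ibar y) := by
    intro x y
    obtain ⟨x, rfl⟩ := hpr x
    obtain ⟨y, rfl⟩ := hpr y
    rw [hIbar, hIbar, he, he, hSI', Int.cast_neg, ZMod.neg_eq_self_mod_two]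
  have heeps : ∀ x y, e (eps Ibar x) y = e x (eps Ibar y) := by
    intro x y
    rw [heps, heps, map_add, LinearMap.add_apply, heII, map_add]
  have he_nd : ∀ x, (∀ y, e x y = 0) → x = 0 := by
    intro x hx
    obtain ⟨x, rfl⟩ := hpr x
    have h1 : ∀ y, ∃ c, S (I x) y = 2 * c := by
      intro y
      have := hx (pr y)
      rw [he] at this
      exact (ZMod.intCast_zmod_eq_zero_iff_dvd _ 2).1 this
    choose c hc using h1
    let φ : Γ →+ ℤ := AddMonoidHom.mk' c (fun a b => by
      have := hc (a + b)
      rw [map_add, hc, hc] at this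
      linarith)
    obtain ⟨z, hz⟩ := hunimod.2 φ.toIntLinearMap
    have hz' : ∀ y, S z y = c y := fun y => LinearMap.congr_fun hz y
    have h2 : I x = 2 • z := by
      apply hunimod.1
      refine LinearMap.ext fun y => ?_
      change S (I x) y = S (2 • z) y
      rw [hc, map_nsmul, LinearMap.smul_apply, hz']
      simp
    rw [hker]
    refine ⟨- I z, ?_⟩
    have h3 := congrArg I h2
    rw [hI2, map_nsmul] at h3
    rw [smul_neg, ← h3, neg_neg]
  have heQ : ∀ x, e x (eps Ibar x) = 0 := by
    intro x
    obtain ⟨x, rfl⟩ := hpr x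
    rw [heps, hIbar, ← map_add, he, map_add, hSI]
    have h0 : S (I x) x = 0 := by
      have := hSI' x x
      rw [hSsymm x (I x)] at this
      omega
    rw [h0, zero_add]
    exact (ZMod.intCast_zmod_eq_zero_iff_dvd _ 2).2 (heven x)
  -- the form b
  obtain ⟨s, hs⟩ := (eps Ibar).rangeRestrict.exists_rightInverse_of_surjective
    (LinearMap.range_eq_top.2 (LinearMap.surjective_rangeRestrict _))
  have hs' : ∀ u : Asub Ibar, eps Ibar (s u) = u := by
    intro u
    have := LinearMap.congr_fun hs u
    exact congrArg Subtype.val this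
  let b : Asub Ibar →ₗ[ZMod 2] Asub Ibar →ₗ[ZMod 2] ZMod 2 :=
    (e.compl₂ (Asub Ibar).subtype).comp s
  have hb : ∀ u v, b u v = e (s u) v := fun _ _ => rfl
  have hbeps : ∀ x y, b (epsEl Ibar x) (epsEl Ibar y) = e x (eps Ibar y) := by
    intro x y
    rw [hb]
    change e (s (epsEl Ibar x)) (eps Ibar y) = _
    rw [← heeps, hs', ← heeps]
    rfl
  have hsur : ∀ u : Asub Ibar, ∃ x, epsEl Ibar x = u := fun u => ⟨s u, Subtype.ext (hs' u)⟩
  have halt : ∀ u, b u u = 0 := by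
    intro u
    obtain ⟨x, rfl⟩ := hsur u
    rw [hbeps, heQ]
  have hnd : ∀ u, (∀ v, b u v = 0) → u = 0 := by
    intro u hu
    obtain ⟨x, rfl⟩ := hsur u
    apply Subtype.ext
    change eps Ibar x = 0
    apply he_nd
    intro y
    rw [heeps, ← hbeps, hu]
  have heps_add : ∀ x y, epsEl Ibar (x + y) = epsEl Ibar x + epsEl Ibar y := fun x y =>
    Subtype.ext (map_add _ _ _)
  have heps_I : ∀ x, epsEl Ibar (Ibar x) = epsEl Ibar x := fun x => Subtype.ext (by
    change eps Ibar (Ibar x) = eps Ibar x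
    rw [heps, heps, hII, add_comm])
  have hQadd : ∀ x y, Q (x + y) = Q x + Q y + emb2 (e x y) + emb2 (e x (eps Ibar y)) := by
    intro x y
    obtain ⟨x, rfl⟩ := hpr x
    obtain ⟨y, rfl⟩ := hpr y
    rw [add_assoc, ← aux_emb2_add, heps, hIbar, map_add (e (pr x)), ← add_assoc, he, he, hSI,
      ← map_add, hQ, hQ, hQ]
    have h1 : ∀ t : ZMod 2, t + t = 0 := by decide
    rw [h1, zero_add]
    have h2 : ∀ n : ℤ, emb2 (n : ZMod 2) = ((2 * n : ℤ) : ZMod 4) := by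
      intro n
      have h3 : ((n : ZMod 4).cast : ZMod 2) = (n : ZMod 2) := by
        have := map_intCast (ZMod.castHom (by norm_num : 2 ∣ 4) (ZMod 2)) n
        simpa using this
      rw [← h3]
      push_cast
      generalize (n : ZMod 4) = t
      revert t; decide
    rw [h2]
    rw [← Int.cast_add, ← Int.cast_add]
    congr 1
    simp only [map_add, LinearMap.add_apply]
    rw [hSsymm y x]
    ring
  have hQI : ∀ x, Q (Ibar x) = Q x := by
    intro x
    obtain ⟨x, rfl⟩ := hpr x
    rw [hIbar, hQ, hQ, hSI]
  have hemb : ∀ t : ZMod 2, emb2 t + emb2 t = 0 := by decide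
  -- target value
  obtain ⟨k, rfl⟩ := h4
  have hk : 1 ≤ k := by omega
  have hg2 : 4 * k / 2 = 2 * k := by omega
  have hg4 : 4 * k / 4 = k := by omega
  have hval : -(2 : ℂ) ^ (4 * k / 2) *
      Complex.exp (-((Real.pi * (4 * k : ℕ) / 4 : ℝ) : ℂ) * Complex.I) =
      ((-(-1) ^ k : ℤ) : ℂ) * 2 ^ (4 * k / 2) := by
    have : Complex.exp (-((Real.pi * (4 * k : ℕ) / 4 : ℝ) : ℂ) * Complex.I) = (-1) ^ k := by
      have h1 : (-((Real.pi * (4 * k : ℕ) / 4 : ℝ) : ℂ) * Complex.I) =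
          k * (-(Real.pi * Complex.I)) := by
        push_cast; ring
      rw [h1, Complex.exp_nat_mul, Complex.exp_neg, Complex.exp_pi_mul_I]
      norm_num
    rw [this]
    push_cast
    ring
  rw [hval]
  have hcount := aux_count halt hnd (4 * k / 2) (by omega) hcardW (-(-1) ^ k) (by
    rcases neg_one_pow_eq_or ℤ k with h | h <;> rw [h] <;> simp)
  rw [hg4, sub_eq_add_neg, ← hcount]
  congr 1
  have hqf : ∀ f ∈ QuadSet (fun x y => b x y), (fun x => Q x + f (epsEl Ibar x)) ∈
        QuadSet (fun x y => e x y) ∩ {q | ∀ x, q (Ibar x) = q x} := by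
    intro f hf1
    constructor
    · intro x y
      beta_reduce
      rw [heps_add, hf1]
      beta_reduce
      rw [hbeps, hQadd]
      linear_combination hemb (e x (eps Ibar y))
    · intro x
      beta_reduce
      rw [heps_I, hQI]
  have hfe : ∀ f ∈ QuadSet (fun x y => b x y), Qmap (fun x => Q x + f (epsEl Ibar x)) = f := by
    intro f hf1
    funext u
    obtain ⟨x, rfl⟩ := hsur u
    rw [hQmap _ (hqf f hf1)]; ring
  refine Nat.card_congr ?_
  refine
    { toFun := fun q => ⟨Qmap q.1, ?_, ?_⟩
      invFun := fun f => ⟨fun x => Q x + f.1 (epsEl Ibar x), (hqf f.1 f.2.1).1,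
        (hqf f.1 f.2.1).2, ?_⟩
      left_inv := ?_
      right_inv := ?_ }
  · obtain ⟨q, hq1, hq2, hq3⟩ := q
    have hm := hQmap q ⟨hq1, hq2⟩
    intro u v
    obtain ⟨x, rfl⟩ := hsur u
    obtain ⟨y, rfl⟩ := hsur v
    simp only
    rw [← heps_add, hm, hm, hm, hbeps, hq1 x y, hQadd]
    linear_combination - hemb (e x (eps Ibar y))
  · have := q.2.2.2
    rwa [finsum_eq_sum_of_fintype] at this
  · obtain ⟨f, hf1, hf2⟩ := f
    simp only
    rw [hfe f hf1, finsum_eq_sum_of_fintype]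
    exact hf2
  · rintro ⟨q, hq1, hq2, hq3⟩
    apply Subtype.ext
    funext x
    simp only
    rw [hQmap q ⟨hq1, hq2⟩]
    ring
  · rintro ⟨f, hf1, hf2⟩
    apply Subtype.ext
    exact hfe f hf1
end

section
/- Let γ ∈ Γ be such that δ := (iγ − γ)/2 belongs to Γ (equivalently, the class γ̄ of γ in A₂ lies in A_i). Then e_δ(γ/2) = i^{Q_q(γ̄)} in ℂ; that is, i^{q(δ̄)}·exp((π/2)·H(δ, γ + δ)) = i^{Q_q(γ̄)}, where δ̄ is the class of δ in A₂. -/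
/-- The standard Hermitian inner product `H(x, y) = ∑_j conj(x_j)·y_j` on `ℂ^g`. -/
noncomputable def Hform (g : ℕ) (x y : Fin g → ℂ) : ℂ :=
  ∑ j, (starRingEnd ℂ) (x j) * y j

theorem iPow_intCast (n : ℤ) : iPow (n : ZMod 4) = Complex.I ^ n := by
  unfold iPow
  have h : (((n : ZMod 4).val : ℕ) : ℤ) = n % 4 := by
    simpa using ZMod.val_intCast (n := 4) n
  rw [← zpow_natCast, h]
  conv_rhs => rw [← Int.emod_add_mul_ediv n 4]
  rw [zpow_add₀ Complex.I_ne_zero, zpow_mul]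
  have : Complex.I ^ (4 : ℤ) = 1 := by exact_mod_cast Complex.I_pow_four
  rw [this, one_zpow, mul_one]

theorem exp_aux (n : ℤ) :
    Complex.exp (((Real.pi : ℂ) / 2) * (-Complex.I * (n : ℂ))) = Complex.I ^ (-n) := by
  have h : ((Real.pi : ℂ) / 2) * (-Complex.I * (n : ℂ))
      = ((-n : ℤ) : ℂ) * ((Real.pi : ℂ) / 2 * Complex.I) := by push_cast; ring
  rw [h, Complex.exp_int_mul, Complex.exp_pi_div_two_mul_I]

/-- Let `γ ∈ Γ` be such that `δ := (iγ − γ)/2` belongs to `Γ`.  Then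
`e_δ(γ/2) = i^{Q_q(γ̄)}`; that is, `i^{q(δ̄)}·exp((π/2)·H(δ, γ + δ)) = i^{Q_q(γ̄)}`, where
`δ̄` is the class of `δ` in `A₂`. -/
theorem statement4 (g : ℕ) (hg : 1 ≤ g)
    (Γ : AddSubgroup (Fin g → ℂ))
    [Module.Free ℤ ↥Γ] [Module.Finite ℤ ↥Γ]
    (hrank : Module.finrank ℤ ↥Γ = 2 * g)
    (hspan : Submodule.span ℝ (Γ : Set (Fin g → ℂ)) = ⊤)
    -- multiplication by `i` preserves `Γ`
    (Imul : ↥Γ →+ ↥Γ)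
    (hImul : ∀ x : ↥Γ, (Imul x : Fin g → ℂ) = Complex.I • (x : Fin g → ℂ))
    -- `H` takes values in `ℤ[i]` on `Γ × Γ`
    (hHint : ∀ x y : ↥Γ, ∃ a b : ℤ, Hform g x y = (a : ℂ) + (b : ℂ) * Complex.I)
    -- `E := Im H` is a unimodular pairing on `Γ`
    (hunimod : ∀ φ : ↥Γ →ₗ[ℤ] ℤ, ∃! x : ↥Γ, ∀ y : ↥Γ, (Hform g x y).im = (φ y : ℝ))
    -- `A₂ := Γ/2Γ`
    (A₂ : Type) [AddCommGroup A₂] [Module (ZMod 2) A₂]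
    (pr : ↥Γ →+ A₂) (hpr : Function.Surjective pr)
    (hker : ∀ x : ↥Γ, pr x = 0 ↔ ∃ y : ↥Γ, x = 2 • y)
    -- the involution `ī` induced by `i`
    (Ibar : A₂ →ₗ[ZMod 2] A₂) (hIbar : ∀ x : ↥Γ, Ibar (pr x) = pr (Imul x))
    -- the symplectic form `e` induced by `E`
    (e : A₂ →ₗ[ZMod 2] A₂ →ₗ[ZMod 2] ZMod 2)
    (he : ∀ x y : ↥Γ, ∀ n : ℤ, (Hform g x y).im = (n : ℝ) → e (pr x) (pr y) = (n : ZMod 2))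
    -- the quadratic form `Q` induced by `x ↦ S(x, x) mod 4`
    (Q : A₂ → ZMod 4)
    (hQ : ∀ x : ↥Γ, ∀ n : ℤ, (Hform g x x).re = (n : ℝ) → Q (pr x) = (n : ZMod 4))
    -- an `ī`-invariant quadratic form `q` associated to `e`
    (q : A₂ → ZMod 4)
    (hq : ∀ x y : A₂, q (x + y) = q x + q y + emb2 (e x y))
    (hqi : ∀ x : A₂, q (Ibar x) = q x)
    -- `Q_q`, determined on `A_i = ε(A₂)` by `Q_q(εα) = q(α) − Q(α)`
    (Qq : A₂ → ZMod 4)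
    (hQq : ∀ α : A₂, Qq (α + Ibar α) = q α - Q α)
    -- the data of the statement
    (γ δ : ↥Γ)
    (hδ : (2 : ℂ) • (δ : Fin g → ℂ) = Complex.I • (γ : Fin g → ℂ) - (γ : Fin g → ℂ)) :
    iPow (q (pr δ)) *
        Complex.exp (((Real.pi : ℂ) / 2) * Hform g δ ((γ : Fin g → ℂ) + (δ : Fin g → ℂ))) =
      iPow (Qq (pr γ)) := by
  have hγ : ∀ j, (γ : Fin g → ℂ) j = -((δ : Fin g → ℂ) j + Complex.I * (δ : Fin g → ℂ) j) := by
    intro j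
    have h := congrFun hδ j
    simp only [Pi.smul_apply, Pi.sub_apply, smul_eq_mul] at h
    linear_combination ((1 + Complex.I) / 2) * h + ((γ : Fin g → ℂ) j / 2) * Complex.I_sq
  have hγ' : γ = -(δ + Imul δ) := by
    apply Subtype.ext
    funext j
    simp [hImul, hγ j]
  have h2 : ∀ x : A₂, -x = x := by
    intro x
    have : x + x = 0 := by
      have h := two_smul (ZMod 2) x
      rw [← h, show (2 : ZMod 2) = 0 from rfl, zero_smul]
    exact neg_eq_of_add_eq_zero_left this
  have hprγ : pr γ = pr δ + Ibar (pr δ) := by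
    rw [hγ', map_neg, h2, map_add, hIbar]
  obtain ⟨n, b, hn⟩ := hHint δ δ
  have him : (Hform g δ δ).im = 0 := by
    unfold Hform
    rw [Complex.im_sum]
    apply Finset.sum_eq_zero
    intro j _
    simp only [Complex.mul_im, Complex.conj_re, Complex.conj_im]
    ring
  have hb : (b : ℝ) = 0 := by
    rw [hn] at him
    simpa using him
  have hb' : (b : ℂ) = 0 := by exact_mod_cast hb
  rw [hb', zero_mul, add_zero] at hn
  have hQδ : Q (pr δ) = (n : ZMod 4) := hQ δ n (by rw [hn]; simp)
  have hH : Hform g δ ((γ : Fin g → ℂ) + (δ : Fin g → ℂ)) = -Complex.I * (n : ℂ) := by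
    rw [← hn]
    unfold Hform
    rw [Finset.mul_sum]
    apply Finset.sum_congr rfl
    intro j _
    rw [Pi.add_apply, hγ j]
    ring
  rw [hH, exp_aux, hprγ, hQq, hQδ]
  obtain ⟨m, hm⟩ := ZMod.intCast_surjective (q (pr δ))
  rw [← hm, ← Int.cast_sub, iPow_intCast, iPow_intCast, ← zpow_add₀ Complex.I_ne_zero,
    sub_eq_add_neg]
end

section
/- There is a unique symmetric F₂-bilinear form b on A_i = ε(A₂) such that b(εα, εβ) = e(α, εβ) for all α, β ∈ A₂ (i.e. the right-hand side depends only on εα and εβ), and this form b is nondegenerate. -/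
/-- There is a unique symmetric `F₂`-bilinear form `b` on `A_i = ε(A₂)` such
that `b(εα, εβ) = e(α, εβ)` for all `α, β ∈ A₂` (i.e. the right-hand side depends only on `εα`
and `εβ`), and this form `b` is nondegenerate. -/
theorem statement5 (g : ℕ) (hg : 1 ≤ g)
    (Γ : Type) [AddCommGroup Γ] [Module ℤ Γ]
    [Module.Free ℤ Γ] [Module.Finite ℤ Γ]
    (hrank : Module.finrank ℤ Γ = 2 * g)
    (S : Γ →ₗ[ℤ] Γ →ₗ[ℤ] ℤ)
    (hSsymm : ∀ x y : Γ, S x y = S y x)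
    (hSpos : ∀ x : Γ, x ≠ 0 → 0 < S x x)
    (I : Γ ≃ₗ[ℤ] Γ)
    (hI2 : ∀ x : Γ, I (I x) = -x)
    (hSI : ∀ x y : Γ, S (I x) (I y) = S x y)
    (hunimod : Function.Bijective fun x : Γ => S x)
    (A₂ : Type) [AddCommGroup A₂] [Module (ZMod 2) A₂]
    (pr : Γ →+ A₂) (hpr : Function.Surjective pr)
    (hker : ∀ x : Γ, pr x = 0 ↔ ∃ y : Γ, x = 2 • y)
    (Ibar : A₂ →ₗ[ZMod 2] A₂) (hIbar : ∀ x : Γ, Ibar (pr x) = pr (I x))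
    (e : A₂ →ₗ[ZMod 2] A₂ →ₗ[ZMod 2] ZMod 2)
    (he : ∀ x y : Γ, e (pr x) (pr y) = ((S (I x) y : ℤ) : ZMod 2)) :
    (∃! b : ↥(Asub Ibar) →ₗ[ZMod 2] ↥(Asub Ibar) →ₗ[ZMod 2] ZMod 2,
      ∀ α β : A₂, b (epsEl Ibar α) (epsEl Ibar β) = e α (eps Ibar β)) ∧
    (∀ b : ↥(Asub Ibar) →ₗ[ZMod 2] ↥(Asub Ibar) →ₗ[ZMod 2] ZMod 2,
      (∀ α β : A₂, b (epsEl Ibar α) (epsEl Ibar β) = e α (eps Ibar β)) →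
      ((∀ x y : ↥(Asub Ibar), b x y = b y x) ∧
       (∀ x : ↥(Asub Ibar), (∀ y : ↥(Asub Ibar), b x y = 0) → x = 0))) := by
  have hneg : ∀ n : ℤ, ((-n : ℤ) : ZMod 2) = (n : ZMod 2) := by
    intro n
    rw [Int.cast_neg, ZModModule.neg_eq_self]
  have hsym : ∀ a c : A₂, e a c = e c a := by
    intro a c
    obtain ⟨x, rfl⟩ := hpr a
    obtain ⟨y, rfl⟩ := hpr c
    rw [he, he, hSsymm (I y) x, ← hSI x (I y), hI2, map_neg, hneg]
  have hadj : ∀ a c : A₂, e (eps Ibar a) c = e a (eps Ibar c) := by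
    intro a c
    obtain ⟨x, rfl⟩ := hpr a
    obtain ⟨y, rfl⟩ := hpr c
    simp only [eps, LinearMap.add_apply, LinearMap.id_apply, map_add, hIbar, he, hI2, hSI,
      map_neg, LinearMap.neg_apply, hneg]
  have hnd : ∀ a : A₂, (∀ c, e a c = 0) → a = 0 := by
    intro a h
    obtain ⟨x, rfl⟩ := hpr a
    have h2 : ∀ y, (2 : ℤ) ∣ S (I x) y := by
      intro y
      have := h (pr y)
      rw [he] at this
      exact (ZMod.intCast_zmod_eq_zero_iff_dvd _ 2).1 this
    let f : Γ →ₗ[ℤ] ℤ :=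
      { toFun := fun y => S (I x) y / 2
        map_add' := fun y z => by
          rw [map_add, Int.add_ediv_of_dvd_left (h2 y)]
        map_smul' := fun c y => by
          simp only [map_smul, smul_eq_mul, RingHom.id_apply]
          rw [Int.mul_ediv_assoc _ (h2 y)] }
    obtain ⟨z, hz⟩ := hunimod.2 f
    have hz' : ∀ y, S z y = S (I x) y / 2 := fun y => by
      have : S z = f := hz
      rw [this]; rfl
    have hIx : I x = z + z := by
      apply hunimod.1
      ext y
      simp only [map_add, LinearMap.add_apply, hz']
      have := h2 y
      omega
    rw [hker]
    refine ⟨-(I z), ?_⟩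
    have h3 := hI2 x
    rw [hIx, map_add] at h3
    rw [two_nsmul, ← neg_add, h3, neg_neg]
  have hsurj : ∀ x : ↥(Asub Ibar), ∃ a, epsEl Ibar a = x := by
    rintro ⟨x, a, rfl⟩
    exact ⟨a, rfl⟩
  refine ⟨?_, ?_⟩
  · obtain ⟨s, hs⟩ := (LinearMap.rangeRestrict (eps Ibar)).exists_rightInverse_of_surjective
      (LinearMap.range_rangeRestrict _)
    have hs' : ∀ x : ↥(Asub Ibar), eps Ibar (s x) = x := fun x =>
      congrArg Subtype.val (LinearMap.congr_fun hs x)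
    refine ⟨e.compl₁₂ s (Asub Ibar).subtype, ?_, ?_⟩
    · intro α β
      change e (s (epsEl Ibar α)) (eps Ibar β) = _
      rw [← hadj, hs', ← hadj]
      rfl
    · intro b hb
      ext x y
      obtain ⟨α, rfl⟩ := hsurj x
      obtain ⟨β, rfl⟩ := hsurj y
      rw [hb]
      change _ = e (s (epsEl Ibar α)) (eps Ibar β)
      rw [← hadj, ← hadj, hs']
      rfl
  · intro b hb
    refine ⟨?_, ?_⟩
    · intro x y
      obtain ⟨α, rfl⟩ := hsurj x
      obtain ⟨β, rfl⟩ := hsurj y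
      rw [hb, hb, ← hadj, hsym]
    · intro x h
      obtain ⟨α, rfl⟩ := hsurj x
      apply Subtype.ext
      change eps Ibar α = 0
      apply hnd
      intro c
      rw [hadj, ← hb]
      exact h _
end

section
/- Let q : A₂ → ℤ/4ℤ be an ī-invariant (q ∘ ī = q) quadratic form associated to e. Then there is a unique map Q_q : A_i → ℤ/4ℤ such that Q_q(εα) = q(α) − Q(α) for all α ∈ A₂ (i.e. q(α) − Q(α) depends only on εα), and Q_q is a quadratic form associated to the bilinear form b on A_i determined by b(εα, εβ) = e(α, εβ). -/
theorem emb2_add (s t : ZMod 2) : emb2 (s + t) = emb2 s + emb2 t := by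
  revert s t; decide

theorem emb2_int (n : ℤ) : emb2 (n : ZMod 2) = 2 * (n : ZMod 4) := by
  rcases Int.even_or_odd' n with ⟨k, rfl | rfl⟩
  · have h : (((2 * k : ℤ)) : ZMod 2) = 0 := by
      push_cast
      have : (2 : ZMod 2) = 0 := by decide
      rw [this, zero_mul]
    rw [h]
    push_cast
    generalize (k : ZMod 4) = t
    revert t; decide
  · have h : (((2 * k + 1 : ℤ)) : ZMod 2) = 1 := by
      push_cast
      have : (2 : ZMod 2) = 0 := by decide
      rw [this, zero_mul, zero_add]
    rw [h]
    push_cast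
    generalize (k : ZMod 4) = t
    revert t; decide

/-- Let `q : A₂ → ℤ/4ℤ` be an `ī`-invariant quadratic form associated to `e`.
Then there is a unique map `Q_q : A_i → ℤ/4ℤ` such that `Q_q(εα) = q(α) − Q(α)` for all
`α ∈ A₂` (i.e. `q(α) − Q(α)` depends only on `εα`), and `Q_q` is a quadratic form associated to
the bilinear form `b` on `A_i` determined by `b(εα, εβ) = e(α, εβ)`. -/
theorem statement6 (g : ℕ) (hg : 1 ≤ g)
    (Γ : Type) [AddCommGroup Γ] [Module ℤ Γ]
    [Module.Free ℤ Γ] [Module.Finite ℤ Γ]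
    (hrank : Module.finrank ℤ Γ = 2 * g)
    (S : Γ →ₗ[ℤ] Γ →ₗ[ℤ] ℤ)
    (hSsymm : ∀ x y : Γ, S x y = S y x)
    (hSpos : ∀ x : Γ, x ≠ 0 → 0 < S x x)
    (I : Γ ≃ₗ[ℤ] Γ)
    (hI2 : ∀ x : Γ, I (I x) = -x)
    (hSI : ∀ x y : Γ, S (I x) (I y) = S x y)
    (hunimod : Function.Bijective fun x : Γ => S x)
    (A₂ : Type) [AddCommGroup A₂] [Module (ZMod 2) A₂]
    (pr : Γ →+ A₂) (hpr : Function.Surjective pr)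
    (hker : ∀ x : Γ, pr x = 0 ↔ ∃ y : Γ, x = 2 • y)
    (Ibar : A₂ →ₗ[ZMod 2] A₂) (hIbar : ∀ x : Γ, Ibar (pr x) = pr (I x))
    (e : A₂ →ₗ[ZMod 2] A₂ →ₗ[ZMod 2] ZMod 2)
    (he : ∀ x y : Γ, e (pr x) (pr y) = ((S (I x) y : ℤ) : ZMod 2))
    (Q : A₂ → ZMod 4)
    (hQ : ∀ x : Γ, Q (pr x) = ((S x x : ℤ) : ZMod 4))
    (b : ↥(Asub Ibar) →ₗ[ZMod 2] ↥(Asub Ibar) →ₗ[ZMod 2] ZMod 2)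
    (hb : ∀ α β : A₂, b (epsEl Ibar α) (epsEl Ibar β) = e α (eps Ibar β))
    (q : A₂ → ZMod 4)
    (hq : ∀ x y : A₂, q (x + y) = q x + q y + emb2 (e x y))
    (hqi : ∀ x : A₂, q (Ibar x) = q x) :
    (∃! Qq : ↥(Asub Ibar) → ZMod 4, ∀ α : A₂, Qq (epsEl Ibar α) = q α - Q α) ∧
    (∀ Qq : ↥(Asub Ibar) → ZMod 4, (∀ α : A₂, Qq (epsEl Ibar α) = q α - Q α) →
      ∀ x y : ↥(Asub Ibar), Qq (x + y) = Qq x + Qq y + emb2 (b x y)) := by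
  have hsI : ∀ a : Γ, S (I a) a = 0 := by
    intro a
    have h1 := hSI a (I a)
    rw [hI2, map_neg, hSsymm a (I a)] at h1
    omega
  have hchar : ∀ α : A₂, α + α = 0 := fun α => by
    rw [← two_smul (ZMod 2) α]
    have : (2 : ZMod 2) = 0 := by decide
    rw [this, zero_smul]
  have hQadd : ∀ α β : A₂, Q (α + β) = Q α + Q β + emb2 (e α (Ibar β)) := by
    intro α β
    obtain ⟨x, rfl⟩ := hpr α
    obtain ⟨y, rfl⟩ := hpr β
    rw [← map_add, hQ, hQ, hQ, hIbar, he, hSI, emb2_int]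
    simp only [map_add, LinearMap.add_apply, hSsymm y x]
    push_cast
    ring
  have hF : ∀ α β : A₂, q (α + β) - Q (α + β) =
      (q α - Q α) + (q β - Q β) + emb2 (e α (eps Ibar β)) := by
    intro α β
    have h2 : eps Ibar β = β + Ibar β := rfl
    rw [hq, hQadd, h2, map_add, emb2_add]
    have : ∀ t : ZMod 2, emb2 t = - emb2 t := by decide
    have h3 := this (e α (Ibar β))
    linear_combination -h3
  have hq0 : q 0 = 0 := by
    have h := hq 0 0
    rw [add_zero, map_zero] at h
    have h0 : emb2 0 = 0 := by decide
    rw [h0] at h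
    linear_combination -h
  have hker0 : ∀ κ : A₂, eps Ibar κ = 0 → q κ - Q κ = 0 := by
    intro κ hκ
    obtain ⟨a, rfl⟩ := hpr κ
    have h2 : eps Ibar (pr a) = pr a + Ibar (pr a) := rfl
    rw [h2, hIbar, ← map_add, hker] at hκ
    obtain ⟨y, hy⟩ := hκ
    have hy2 : a = y - I y := by
      apply hunimod.1
      apply LinearMap.ext
      intro z
      have e1 : S (a + I a) z = 2 * S y z := by
        rw [hy, two_nsmul, map_add, LinearMap.add_apply]; ring
      have e2 : S (I (a + I a)) z = 2 * S (I y) z := by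
        rw [hy, two_nsmul, map_add, map_add, LinearMap.add_apply]; ring
      rw [map_add, hI2] at e2
      simp only [map_add, map_neg, map_sub, LinearMap.add_apply, LinearMap.neg_apply,
        LinearMap.sub_apply] at e1 e2 ⊢
      omega
    have hneg : pr a = pr y + Ibar (pr y) := by
      rw [hy2, map_sub, hIbar, sub_eq_add_neg, neg_eq_of_add_eq_zero_left (hchar _)]
    have hqy : q (pr y) + q (pr y) = 0 := by
      have h := hq (pr y) (pr y)
      rw [hchar, hq0, he, hsI] at h
      have h0 : emb2 ((0 : ℤ) : ZMod 2) = 0 := by decide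
      rw [h0, add_zero] at h
      exact h.symm
    have hQi : Q (Ibar (pr y)) = Q (pr y) := by rw [hIbar, hQ, hQ, hSI]
    have hII : Ibar (Ibar (pr y)) = pr y := by
      rw [hIbar, hIbar, hI2, map_neg, neg_eq_of_add_eq_zero_left (hchar _)]
    have hee : e (pr y) (pr y) = 0 := by rw [he, hsI]; rfl
    have h0 : emb2 0 = 0 := by decide
    rw [hneg, hq, hQadd, hqi, hQi, hqy, hII, hee, h0, hIbar, he, hSI, hQ, emb2_int]
    ring
  have hwd : ∀ α β : A₂, eps Ibar α = eps Ibar β → q α - Q α = q β - Q β := by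
    intro α β h
    have hk : eps Ibar (α - β) = 0 := by rw [map_sub, h, sub_self]
    have h1 := hF β (α - β)
    have h0 : emb2 0 = 0 := by decide
    rw [hker0 _ hk, hk, map_zero, h0, add_sub_cancel] at h1
    simpa using h1
  have hsurj : ∀ x : ↥(Asub Ibar), ∃ α, epsEl Ibar α = x := by
    rintro ⟨x, α, rfl⟩
    exact ⟨α, rfl⟩
  refine ⟨?_, ?_⟩
  · choose f hf using hsurj
    refine ⟨fun x => q (f x) - Q (f x), ?_, ?_⟩
    · intro α
      exact hwd _ _ (congrArg Subtype.val (hf (epsEl Ibar α)))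
    · intro P hP
      funext x
      have := hP (f x)
      rwa [hf] at this
  · intro P hP x y
    obtain ⟨α, rfl⟩ := hsurj x
    obtain ⟨β, rfl⟩ := hsurj y
    have hadd : epsEl Ibar α + epsEl Ibar β = epsEl Ibar (α + β) :=
      Subtype.ext (map_add (eps Ibar) α β).symm
    rw [hadd, hP, hP, hP, hb, hF]
end

section
/- Let Γ be a unimodular Gaussian lattice of rank 2g. Then: (a) E(x, y) mod 2 depends only on the classes of x, y in A₂ = Γ/2Γ, so E induces a well-defined F₂-bilinear form e on A₂, and e is alternating and nondegenerate; (b) e(α, εβ) = e(εα, β) for all α, β ∈ A₂, and hence e(εα, εβ) = 0 for all α, β; (c) A_i = ε(A₂) is a Lagrangian subspace of (A₂, e), i.e. A_i equals its own orthogonal complement with respect to e. -/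
/-- Let `Γ` be a unimodular Gaussian lattice of rank `2g`.  Then:
(a) `E(x, y) mod 2` depends only on the classes of `x, y` in `A₂ = Γ/2Γ`, so `E` induces a
well-defined `F₂`-bilinear form `e` on `A₂`, and `e` is alternating and nondegenerate;
(b) `e(α, εβ) = e(εα, β)` for all `α, β ∈ A₂`, and hence `e(εα, εβ) = 0` for all `α, β`;
(c) `A_i = ε(A₂)` is a Lagrangian subspace of `(A₂, e)`, i.e. `A_i` equals its own orthogonal
complement with respect to `e`.  (Here `E(x, y) := S(ix, y)`.) -/
theorem statement10 (g : ℕ) (hg : 1 ≤ g)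
    (Γ : Type) [AddCommGroup Γ] [Module ℤ Γ]
    [Module.Free ℤ Γ] [Module.Finite ℤ Γ]
    (hrank : Module.finrank ℤ Γ = 2 * g)
    (S : Γ →ₗ[ℤ] Γ →ₗ[ℤ] ℤ)
    (hSsymm : ∀ x y : Γ, S x y = S y x)
    (hSpos : ∀ x : Γ, x ≠ 0 → 0 < S x x)
    (I : Γ ≃ₗ[ℤ] Γ)
    (hI2 : ∀ x : Γ, I (I x) = -x)
    (hSI : ∀ x y : Γ, S (I x) (I y) = S x y)
    (hunimod : Function.Bijective fun x : Γ => S x)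
    (A₂ : Type) [AddCommGroup A₂] [Module (ZMod 2) A₂]
    (pr : Γ →+ A₂) (hpr : Function.Surjective pr)
    (hker : ∀ x : Γ, pr x = 0 ↔ ∃ y : Γ, x = 2 • y)
    (Ibar : A₂ →ₗ[ZMod 2] A₂) (hIbar : ∀ x : Γ, Ibar (pr x) = pr (I x)) :
    -- (a) well-definedness of `e`
    (∀ x x' y y' : Γ, pr x = pr x' → pr y = pr y' →
      ((S (I x) y : ℤ) : ZMod 2) = ((S (I x') y' : ℤ) : ZMod 2)) ∧
    (∃! e : A₂ →ₗ[ZMod 2] A₂ →ₗ[ZMod 2] ZMod 2,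
      ∀ x y : Γ, e (pr x) (pr y) = ((S (I x) y : ℤ) : ZMod 2)) ∧
    (∀ e : A₂ →ₗ[ZMod 2] A₂ →ₗ[ZMod 2] ZMod 2,
      (∀ x y : Γ, e (pr x) (pr y) = ((S (I x) y : ℤ) : ZMod 2)) →
      -- (a) alternating and nondegenerate
      ((∀ a : A₂, e a a = 0) ∧
       (∀ a : A₂, (∀ b : A₂, e a b = 0) → a = 0) ∧
       -- (b)
       (∀ α β : A₂, e α (eps Ibar β) = e (eps Ibar α) β) ∧
       (∀ α β : A₂, e (eps Ibar α) (eps Ibar β) = 0) ∧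
       -- (c) `A_i` is Lagrangian
       (∀ x : A₂, x ∈ Asub Ibar ↔ ∀ y ∈ Asub Ibar, e x y = 0))) := by
  have two : ∀ n : ℤ, ((2 * n : ℤ) : ZMod 2) = 0 := by
    intro n
    push_cast
    rw [show (2 : ZMod 2) = 0 from rfl, zero_mul]
  have hwd : ∀ x x' y y' : Γ, pr x = pr x' → pr y = pr y' →
      ((S (I x) y : ℤ) : ZMod 2) = ((S (I x') y' : ℤ) : ZMod 2) := by
    intro x x' y y' hx hy
    obtain ⟨u, hu⟩ := (hker (x - x')).1 (by rw [map_sub, hx, sub_self])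
    obtain ⟨v, hv⟩ := (hker (y - y')).1 (by rw [map_sub, hy, sub_self])
    have hx' : x = x' + (u + u) := by rw [← two_nsmul, ← hu]; abel
    have hy' : y = y' + (v + v) := by rw [← two_nsmul, ← hv]; abel
    have : S (I x) y = S (I x') y' +
        2 * (S (I x') v + S (I u) y' + 2 * S (I u) v) := by
      rw [hx', hy']
      simp only [map_add, LinearMap.add_apply]
      ring
    rw [this, Int.cast_add, two, add_zero]
  have key : ∀ x, pr (x + x) = 0 := fun x => (hker _).2 ⟨x, (two_nsmul x).symm⟩
  refine ⟨hwd, ?_, ?_⟩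
  · choose s hs using hpr
    have hadd : ∀ x y z : Γ, S (I (x + y)) z = S (I x) z + S (I y) z := by
      intro x y z
      rw [map_add, map_add, LinearMap.add_apply]
    have h1 : ∀ a a' b, ((S (I (s (a + a'))) (s b) : ℤ) : ZMod 2)
        = ((S (I (s a)) (s b) : ℤ) : ZMod 2) + ((S (I (s a')) (s b) : ℤ) : ZMod 2) := by
      intro a a' b
      rw [← Int.cast_add, ← hadd]
      exact hwd _ _ _ _ (by simp [hs]) rfl
    have h3 : ∀ a b b', ((S (I (s a)) (s (b + b')) : ℤ) : ZMod 2)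
        = ((S (I (s a)) (s b) : ℤ) : ZMod 2) + ((S (I (s a)) (s b') : ℤ) : ZMod 2) := by
      intro a b b'
      rw [← Int.cast_add, ← map_add]
      exact hwd _ _ _ _ rfl (by simp [hs])
    have hc : ∀ c : ZMod 2, c = 0 ∨ c = 1 := by decide
    refine ⟨LinearMap.mk₂ (ZMod 2) (fun a b => ((S (I (s a)) (s b) : ℤ) : ZMod 2))
      h1 ?_ h3 ?_, ?_, ?_⟩
    · intro c a b
      rcases hc c with rfl | rfl
      · have := h1 0 0 b
        simp only [add_zero] at this
        simp only [zero_smul]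
        exact left_eq_add.1 this
      · simp only [one_smul]
    · intro c a b
      rcases hc c with rfl | rfl
      · have := h3 a 0 0
        simp only [add_zero] at this
        simp only [zero_smul]
        exact left_eq_add.1 this
      · simp only [one_smul]
    · intro x y
      exact hwd _ _ _ _ (hs _) (hs _)
    · intro e he
      ext a b
      rw [LinearMap.mk₂_apply, ← he, hs, hs]
  · intro e he
    have hepr : ∀ x, eps Ibar (pr x) = pr (x + I x) := by
      intro x
      simp [eps, hIbar]
    have nondeg : ∀ a : A₂, (∀ b : A₂, e a b = 0) → a = 0 := by
      intro a ha
      obtain ⟨x, rfl⟩ := hpr a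
      have hd : ∀ y, ∃ k, S (I x) y = 2 * k := by
        intro y
        have := ha (pr y)
        rw [he] at this
        exact (ZMod.intCast_zmod_eq_zero_iff_dvd _ 2).1 this
      choose f hf using hd
      let F : Γ →+ ℤ := 
        { toFun := f
          map_zero' := by have := hf 0; rw [map_zero] at this; omega
          map_add' := by
            intro y z
            have h1 := hf (y + z)
            rw [map_add, hf, hf] at h1
            omega }
      obtain ⟨z, hz⟩ := hunimod.2
        { toFun := F, map_add' := F.map_add, map_smul' := by
            intro c y
            have h1 := (S (I x)).map_smul c y
            rw [hf, hf, smul_eq_mul, mul_left_comm] at h1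
            exact mul_left_cancel₀ two_ne_zero h1 }
      have hIx : I x = z + z := by
        apply hunimod.1
        ext y
        have h2 : S z y = f y := by
          have := congrArg (fun G : Γ →ₗ[ℤ] ℤ => G y) hz
          exact this
        simp only [map_add, LinearMap.add_apply, h2, hf]
        ring
      have : x = -(I z) + -(I z) := by
        have h4 := hI2 x
        rw [hIx, map_add] at h4
        rw [← neg_add, h4, neg_neg]
      rw [this]
      exact key _
    have hb : ∀ α β : A₂, e α (eps Ibar β) = e (eps Ibar α) β := by
      intro a b
      obtain ⟨x, rfl⟩ := hpr a
      obtain ⟨y, rfl⟩ := hpr b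
      rw [hepr, hepr, he, he]
      have : S (I x) (y + I y) = S (I (x + I x)) y + 2 * S x y := by
        simp only [map_add, LinearMap.add_apply, hSI, hI2, map_neg, LinearMap.neg_apply]
        ring
      rw [this, Int.cast_add, two, add_zero]
    have hee : ∀ b, eps Ibar (eps Ibar b) = 0 := by
      intro b
      obtain ⟨y, rfl⟩ := hpr b
      rw [hepr, hepr, ← key (I y)]
      congr 1
      rw [map_add, hI2]
      abel
    have hb2 : ∀ α β : A₂, e (eps Ibar α) (eps Ibar β) = 0 := by
      intro a b
      rw [← hb, hee, map_zero]
    refine ⟨?_, nondeg, hb, hb2, ?_⟩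
    · intro a
      obtain ⟨x, rfl⟩ := hpr a
      rw [he]
      have h := hSI (I x) x
      rw [hI2, map_neg, LinearMap.neg_apply, hSsymm x] at h
      have : S (I x) x = 0 := by omega
      rw [this, Int.cast_zero]
    · intro a
      constructor
      · rintro ⟨b, rfl⟩ y ⟨c, rfl⟩
        exact hb2 _ _
      · intro h
        have h0 : eps Ibar a = 0 := nondeg _ fun b => by
          rw [← hb]
          exact h _ ⟨b, rfl⟩
        obtain ⟨x, rfl⟩ := hpr a
        rw [hepr] at h0
        obtain ⟨y, hy⟩ := (hker _).1 h0
        rw [two_nsmul] at hy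
        have hy2 := congrArg I hy
        rw [map_add, map_add, hI2] at hy2
        have hx : S x = S (y - I y) := by
          ext w
          have e1 := congrArg (fun t => S t w) hy
          have e2 := congrArg (fun t => S t w) hy2
          simp only [map_add, map_neg, map_sub, LinearMap.add_apply, LinearMap.neg_apply,
            LinearMap.sub_apply] at e1 e2 ⊢
          omega
        have hx' : x = y - I y := hunimod.1 hx
        refine ⟨pr y, ?_⟩
        rw [hepr, hx', ← sub_eq_zero, ← map_sub, ← key (I y)]
        congr 1
        abel
end

section
/- Let Γ be a unimodular Gaussian lattice of rank 2g. Then S(x, x) mod 4 depends only on the class of x in A₂ = Γ/2Γ, so x ↦ S(x, x) mod 4 induces a well-defined map Q : A₂ → ℤ/4ℤ; Q is a quadratic form associated to the symmetric bilinear form (α, β) ↦ e(α, īβ), i.e. Q(α + β) = Q(α) + Q(β) + 2e(α, īβ) for all α, β ∈ A₂; and Q(εα) = 2Q(α) = 2e(α, īα) for all α ∈ A₂. -/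
theorem emb2_intCast (n : ℤ) : emb2 ((n : ℤ) : ZMod 2) = ((2 * n : ℤ) : ZMod 4) := by
  have h4 : (4 : ZMod 4) = 0 := by decide
  rcases Int.even_or_odd' n with ⟨k, rfl | rfl⟩
  · have h : ((2 * k : ℤ) : ZMod 2) = 0 := by
      push_cast
      rw [show (2 : ZMod 2) = 0 by decide, zero_mul]
    rw [h]
    push_cast
    rw [← mul_assoc, show (2 * 2 : ZMod 4) = 0 by decide, zero_mul]
    decide
  · have h : ((2 * k + 1 : ℤ) : ZMod 2) = 1 := by
      push_cast
      rw [show (2 : ZMod 2) = 0 by decide, zero_mul, zero_add]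
    rw [h]
    push_cast
    rw [mul_add, ← mul_assoc, show (2 * 2 : ZMod 4) = 0 by decide, zero_mul]
    decide

/-- Let `Γ` be a unimodular Gaussian lattice of rank `2g`.  Then
`S(x, x) mod 4` depends only on the class of `x` in `A₂ = Γ/2Γ`, so `x ↦ S(x, x) mod 4`
induces a well-defined map `Q : A₂ → ℤ/4ℤ`; `Q` is a quadratic form associated to the
symmetric bilinear form `(α, β) ↦ e(α, īβ)`, i.e. `Q(α + β) = Q(α) + Q(β) + 2e(α, īβ)` for
all `α, β ∈ A₂`; and `Q(εα) = 2Q(α) = 2e(α, īα)` for all `α ∈ A₂`. -/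
theorem statement11 (g : ℕ) (hg : 1 ≤ g)
    (Γ : Type) [AddCommGroup Γ] [Module ℤ Γ]
    [Module.Free ℤ Γ] [Module.Finite ℤ Γ]
    (hrank : Module.finrank ℤ Γ = 2 * g)
    (S : Γ →ₗ[ℤ] Γ →ₗ[ℤ] ℤ)
    (hSsymm : ∀ x y : Γ, S x y = S y x)
    (hSpos : ∀ x : Γ, x ≠ 0 → 0 < S x x)
    (I : Γ ≃ₗ[ℤ] Γ)
    (hI2 : ∀ x : Γ, I (I x) = -x)
    (hSI : ∀ x y : Γ, S (I x) (I y) = S x y)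
    (hunimod : Function.Bijective fun x : Γ => S x)
    (A₂ : Type) [AddCommGroup A₂] [Module (ZMod 2) A₂]
    (pr : Γ →+ A₂) (hpr : Function.Surjective pr)
    (hker : ∀ x : Γ, pr x = 0 ↔ ∃ y : Γ, x = 2 • y)
    (Ibar : A₂ →ₗ[ZMod 2] A₂) (hIbar : ∀ x : Γ, Ibar (pr x) = pr (I x))
    (e : A₂ →ₗ[ZMod 2] A₂ →ₗ[ZMod 2] ZMod 2)
    (he : ∀ x y : Γ, e (pr x) (pr y) = ((S (I x) y : ℤ) : ZMod 2)) :
    -- well-definedness of `Q`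
    (∀ x y : Γ, pr x = pr y → ((S x x : ℤ) : ZMod 4) = ((S y y : ℤ) : ZMod 4)) ∧
    (∃! Q : A₂ → ZMod 4, ∀ x : Γ, Q (pr x) = ((S x x : ℤ) : ZMod 4)) ∧
    (∀ Q : A₂ → ZMod 4, (∀ x : Γ, Q (pr x) = ((S x x : ℤ) : ZMod 4)) →
      -- `Q` is a quadratic form associated to `(α, β) ↦ e(α, īβ)`
      ((∀ α β : A₂, Q (α + β) = Q α + Q β + emb2 (e α (Ibar β))) ∧
       -- `Q(εα) = 2Q(α) = 2e(α, īα)`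
       (∀ α : A₂, Q (eps Ibar α) = 2 * Q α) ∧
       (∀ α : A₂, 2 * Q α = emb2 (e α (Ibar α))))) := by
  have hadd : ∀ x y : Γ, S (x + y) (x + y) = S x x + S y y + 2 * S x y := by
    intro x y
    simp only [map_add, LinearMap.add_apply]
    rw [hSsymm y x]
    ring
  have hzero : ∀ x : Γ, S x (I x) = 0 := by
    intro x
    have h := hSI x (I x)
    rw [hI2, map_neg, hSsymm (I x) x] at h
    linarith
  have hwd : ∀ x y : Γ, pr x = pr y → ((S x x : ℤ) : ZMod 4) = ((S y y : ℤ) : ZMod 4) := by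
    intro x y hxy
    obtain ⟨z, hz⟩ := (hker (x - y)).1 (by rw [map_sub, hxy, sub_self])
    have hx : x = y + (z + z) := by
      rw [← two_nsmul, ← hz]; abel
    have h : S x x = S y y + 4 * (S z z + S y z) := by
      rw [hx, hadd, hadd z z, map_add]
      ring
    rw [h]
    push_cast
    rw [show (4 : ZMod 4) = 0 by decide, zero_mul, add_zero]
  refine ⟨hwd, ?_, ?_⟩
  · choose s hs using hpr
    refine ⟨fun a => ((S (s a) (s a) : ℤ) : ZMod 4), fun x => hwd _ _ (hs _), ?_⟩
    intro Q hQ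
    funext a
    rw [← hQ, hs]
  · intro Q hQ
    refine ⟨?_, ?_, ?_⟩
    · intro α β
      obtain ⟨x, rfl⟩ := hpr α
      obtain ⟨y, rfl⟩ := hpr β
      rw [← map_add, hQ, hQ, hQ, hIbar, he, hSI, emb2_intCast, hadd]
      push_cast
      ring
    · intro α
      obtain ⟨x, rfl⟩ := hpr α
      have h : eps Ibar (pr x) = pr (x + I x) := by
        simp [eps, hIbar]
      rw [h, hQ, hQ, hadd, hSI, hzero]
      push_cast
      ring
    · intro α
      obtain ⟨x, rfl⟩ := hpr α
      rw [hQ, hIbar, he, hSI, emb2_intCast]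
      push_cast
      ring
end

section
/- For every α ∈ A₂ one has b(εα, εα) = Q(α) mod 2 (under the isomorphism F₂ ≅ 2ℤ/4ℤ). Consequently, the symmetric bilinear form b on A_i is alternating (b(x, x) = 0 for all x ∈ A_i) if and only if the lattice Γ is even (S(x, x) ∈ 2ℤ for all x ∈ Γ). -/
/-- For every `α ∈ A₂` one has `b(εα, εα) = Q(α) mod 2` (under the
isomorphism `F₂ ≅ 2ℤ/4ℤ`).  Consequently, the symmetric bilinear form `b` on `A_i` is
alternating if and only if the lattice `Γ` is even (`S(x, x) ∈ 2ℤ` for all `x ∈ Γ`). -/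
theorem statement12 (g : ℕ) (hg : 1 ≤ g)
    (Γ : Type) [AddCommGroup Γ] [Module ℤ Γ]
    [Module.Free ℤ Γ] [Module.Finite ℤ Γ]
    (hrank : Module.finrank ℤ Γ = 2 * g)
    (S : Γ →ₗ[ℤ] Γ →ₗ[ℤ] ℤ)
    (hSsymm : ∀ x y : Γ, S x y = S y x)
    (hSpos : ∀ x : Γ, x ≠ 0 → 0 < S x x)
    (I : Γ ≃ₗ[ℤ] Γ)
    (hI2 : ∀ x : Γ, I (I x) = -x)
    (hSI : ∀ x y : Γ, S (I x) (I y) = S x y)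
    (hunimod : Function.Bijective fun x : Γ => S x)
    (A₂ : Type) [AddCommGroup A₂] [Module (ZMod 2) A₂]
    (pr : Γ →+ A₂) (hpr : Function.Surjective pr)
    (hker : ∀ x : Γ, pr x = 0 ↔ ∃ y : Γ, x = 2 • y)
    (Ibar : A₂ →ₗ[ZMod 2] A₂) (hIbar : ∀ x : Γ, Ibar (pr x) = pr (I x))
    (e : A₂ →ₗ[ZMod 2] A₂ →ₗ[ZMod 2] ZMod 2)
    (he : ∀ x y : Γ, e (pr x) (pr y) = ((S (I x) y : ℤ) : ZMod 2))
    (Q : A₂ → ZMod 4)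
    (hQ : ∀ x : Γ, Q (pr x) = ((S x x : ℤ) : ZMod 4))
    (b : ↥(Asub Ibar) →ₗ[ZMod 2] ↥(Asub Ibar) →ₗ[ZMod 2] ZMod 2)
    (hb : ∀ α β : A₂, b (epsEl Ibar α) (epsEl Ibar β) = e α (eps Ibar β)) :
    (∀ α : A₂, emb2 (b (epsEl Ibar α) (epsEl Ibar α)) = 2 * Q α) ∧
    ((∀ x : ↥(Asub Ibar), b x x = 0) ↔ ∀ x : Γ, 2 ∣ S x x) := by
  have hz : ∀ x : Γ, S (I x) x = 0 := by
    intro x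
    have h1 := hSI (I x) x
    rw [hI2, map_neg, LinearMap.neg_apply, hSsymm x (I x)] at h1
    omega
  have key : ∀ x : Γ, b (epsEl Ibar (pr x)) (epsEl Ibar (pr x)) = ((S x x : ℤ) : ZMod 2) := by
    intro x
    have h2 : eps Ibar (pr x) = pr x + pr (I x) := by
      rw [← hIbar]; rfl
    rw [hb, h2, map_add, he, he, hz, hSI]
    simp
  have hemb : ∀ n : ℤ, emb2 ((n : ℤ) : ZMod 2) = 2 * ((n : ℤ) : ZMod 4) := by
    intro n
    have h4 : ((n : ℤ) : ZMod 2) = ZMod.castHom (show 2 ∣ 4 by norm_num) (ZMod 2) ((n : ℤ) : ZMod 4) := by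
      simp
    rw [h4]
    generalize ((n : ℤ) : ZMod 4) = m
    revert m
    unfold emb2
    decide
  refine ⟨?_, ?_, ?_⟩
  · intro α
    obtain ⟨x, rfl⟩ := hpr α
    rw [key, hQ, hemb]
  · intro h x
    have h1 := h (epsEl Ibar (pr x))
    rw [key] at h1
    exact (ZMod.intCast_zmod_eq_zero_iff_dvd _ 2).1 h1
  · rintro h ⟨_, α, rfl⟩
    obtain ⟨x, rfl⟩ := hpr α
    exact (key x).trans ((ZMod.intCast_zmod_eq_zero_iff_dvd _ 2).2 (h x))
end

section
/- Suppose Γ is even (S(x, x) ∈ 2ℤ for all x ∈ Γ). Then a quadratic form q ∈ 𝒬_e is ī-invariant if and only if q vanishes identically on A_i; that is, 𝒬_e^{(i)} = { q ∈ 𝒬_e : q(α) = 0 for all α ∈ A_i }. -/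
/-- Suppose `Γ` is even (`S(x, x) ∈ 2ℤ` for all `x ∈ Γ`).  Then a quadratic
form `q ∈ 𝒬_e` is `ī`-invariant if and only if `q` vanishes identically on `A_i`; that is,
`𝒬_e^{(i)} = { q ∈ 𝒬_e : q(α) = 0 for all α ∈ A_i }`. -/
theorem statement13 (g : ℕ) (hg : 1 ≤ g)
    (Γ : Type) [AddCommGroup Γ] [Module ℤ Γ]
    [Module.Free ℤ Γ] [Module.Finite ℤ Γ]
    (hrank : Module.finrank ℤ Γ = 2 * g)
    (S : Γ →ₗ[ℤ] Γ →ₗ[ℤ] ℤ)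
    (hSsymm : ∀ x y : Γ, S x y = S y x)
    (hSpos : ∀ x : Γ, x ≠ 0 → 0 < S x x)
    (I : Γ ≃ₗ[ℤ] Γ)
    (hI2 : ∀ x : Γ, I (I x) = -x)
    (hSI : ∀ x y : Γ, S (I x) (I y) = S x y)
    (hunimod : Function.Bijective fun x : Γ => S x)
    (heven : ∀ x : Γ, 2 ∣ S x x)
    (A₂ : Type) [AddCommGroup A₂] [Module (ZMod 2) A₂]
    (pr : Γ →+ A₂) (hpr : Function.Surjective pr)
    (hker : ∀ x : Γ, pr x = 0 ↔ ∃ y : Γ, x = 2 • y)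
    (Ibar : A₂ →ₗ[ZMod 2] A₂) (hIbar : ∀ x : Γ, Ibar (pr x) = pr (I x))
    (e : A₂ →ₗ[ZMod 2] A₂ →ₗ[ZMod 2] ZMod 2)
    (he : ∀ x y : Γ, e (pr x) (pr y) = ((S (I x) y : ℤ) : ZMod 2)) :
    ∀ q ∈ QuadSet (fun x y => e x y),
      ((∀ x : A₂, q (Ibar x) = q x) ↔ ∀ α ∈ Asub Ibar, q α = 0) := by
  intro q hq
  have hq' : ∀ x y, q (x + y) = q x + q y + emb2 (e x y) := hq
  have e0 : emb2 0 = 0 := by decide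
  have q0 : q 0 = 0 := by
    have h := hq' 0 0
    simp only [add_zero, map_zero, e0] at h
    simpa using h
  have hA : ∀ x : A₂, x + x = 0 := by
    intro x
    have h : ((1 : ZMod 2) + 1) • x = 0 := by
      rw [show ((1 : ZMod 2) + 1) = 0 by decide, zero_smul]
    rwa [add_smul, one_smul] at h
  have hxx : ∀ x : A₂, q x + q x = 0 := by
    intro x
    obtain ⟨y, rfl⟩ := hpr x
    have h := hq' (pr y) (pr y)
    have hs : S (I y) y = 0 := by
      have h1 := hSI (I y) y
      rw [hI2, map_neg, LinearMap.neg_apply, hSsymm y (I y)] at h1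
      omega
    rw [hA, q0, he, hs, Int.cast_zero, e0, add_zero] at h
    exact h.symm
  have hxI : ∀ x : A₂, q (x + Ibar x) = q x + q (Ibar x) := by
    intro x
    obtain ⟨y, rfl⟩ := hpr x
    have hs : ((S (I y) (I y) : ℤ) : ZMod 2) = 0 := by
      rw [ZMod.intCast_zmod_eq_zero_iff_dvd]
      exact_mod_cast heven (I y)
    rw [hq', hIbar, he, hs, e0, add_zero]
  constructor
  · rintro h _ ⟨x, rfl⟩
    change q (x + Ibar x) = 0
    rw [hxI, h, hxx]
  · intro h x
    have h1 : q (x + Ibar x) = 0 := h _ ⟨x, rfl⟩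
    rw [hxI] at h1
    exact add_left_cancel (h1.trans (hxx x).symm)
end

section
/- Let V be a 2m-dimensional vector space over F₂ with a nondegenerate alternating bilinear form B. Every map q : V → F₂ with q(x + y) = q(x) + q(y) + B(x, y) for all x, y satisfies ∑_{x ∈ V} (−1)^{q(x)} = ±2^m; the number of such q with ∑_{x ∈ V} (−1)^{q(x)} = 2^m (Arf invariant 0) is 2^{m−1}(2^m + 1), and the number with ∑_{x ∈ V} (−1)^{q(x)} = −2^m (Arf invariant 1) is 2^{m−1}(2^m − 1). -/
namespace Arf17

def chi (a : ZMod 2) : ℤ := (-1 : ℤ) ^ a.val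

lemma chi_add (a b : ZMod 2) : chi (a + b) = chi a * chi b := by
  revert a b; unfold chi; decide

lemma chi_zero : chi 0 = 1 := by unfold chi; decide

lemma dbl (a : ZMod 2) : a + a = 0 := by revert a; decide

variable {V : Type} [AddCommGroup V] [Module (ZMod 2) V]

lemma symmB (B : V →ₗ[ZMod 2] V →ₗ[ZMod 2] ZMod 2) (halt : ∀ x : V, B x x = 0) (x y : V) :
    B x y = B y x := by
  have h := halt (x + y)
  simp only [map_add, LinearMap.add_apply, halt] at h
  have h2 := dbl (B x y)
  linear_combination h - dbl (B y x)

lemma charsum [Fintype V] [DecidableEq V] (B : V →ₗ[ZMod 2] V →ₗ[ZMod 2] ZMod 2)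
    (halt : ∀ x : V, B x x = 0)
    (hnd : ∀ x : V, (∀ y : V, B x y = 0) → x = 0) (z : V) :
    ∑ x : V, chi (B x z) = if z = 0 then (Fintype.card V : ℤ) else 0 := by
  split_ifs with h
  · subst h; simp [chi_zero]
  · have : ∃ x, B x z = 1 := by
      by_contra hc
      push Not at hc
      refine h (hnd z fun y => ?_)
      have h1 := hc y
      rw [symmB B halt z y]
      generalize B y z = a at *
      revert a; decide
    obtain ⟨x0, hx0⟩ := this
    have e : ∑ x : V, chi (B x z) = ∑ x : V, chi (B (x + x0) z) :=
      (Equiv.sum_comp (Equiv.addRight x0) (fun x => chi (B x z))).symm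
    simp only [map_add, LinearMap.add_apply, hx0, chi_add] at e
    rw [← Finset.sum_mul] at e
    have : chi 1 = -1 := by unfold chi; decide
    rw [this] at e
    linarith

lemma sq [Fintype V] (B : V →ₗ[ZMod 2] V →ₗ[ZMod 2] ZMod 2)
    (halt : ∀ x : V, B x x = 0)
    (hnd : ∀ x : V, (∀ y : V, B x y = 0) → x = 0)
    (q : V → ZMod 2) (hq : ∀ x y : V, q (x + y) = q x + q y + B x y) :
    (∑ x : V, chi (q x)) ^ 2 = Fintype.card V := by
  classical
  have q0 : q 0 = 0 := by simpa using hq 0 0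
  calc (∑ x : V, chi (q x)) ^ 2 = ∑ x : V, ∑ y : V, chi (q x) * chi (q y) := by
        rw [_root_.sq, Finset.sum_mul_sum]
    _ = ∑ x : V, ∑ z : V, chi (q z) * chi (B x z) := by
        refine Finset.sum_congr rfl fun x _ => ?_
        rw [← Equiv.sum_comp (Equiv.addLeft x)]
        refine Finset.sum_congr rfl fun z _ => ?_
        rw [← chi_add, ← chi_add]
        simp only [Equiv.coe_addLeft, hq]
        congr 1
        linear_combination dbl (q x)
    _ = ∑ z : V, chi (q z) * ∑ x : V, chi (B x z) := by
        rw [Finset.sum_comm]; simp only [Finset.mul_sum]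
    _ = _ := by
        simp [charsum B halt hnd, q0, chi_zero]

lemma exq [Finite V] (B : V →ₗ[ZMod 2] V →ₗ[ZMod 2] ZMod 2) (halt : ∀ x : V, B x x = 0) :
    ∃ q : V → ZMod 2, ∀ x y : V, q (x + y) = q x + q y + B x y := by
  let b := Module.finBasis (ZMod 2) V
  refine ⟨fun x => ∑ i, ∑ j, if i < j then b.repr x i * b.repr x j * B (b i) (b j) else 0, ?_⟩
  intro x y
  have hB : B x y = ∑ i, ∑ j, b.repr x i * b.repr y j * B (b i) (b j) := by
    conv_lhs => rw [← b.sum_repr x, ← b.sum_repr y]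
    simp only [map_sum, map_smul, LinearMap.sum_apply, LinearMap.smul_apply, smul_eq_mul,
      Finset.mul_sum]
    rw [Finset.sum_comm]
    refine Finset.sum_congr rfl fun i _ => Finset.sum_congr rfl fun j _ => ?_
    ring
  have hB2 : B x y = (∑ i, ∑ j, if i < j then b.repr x i * b.repr y j * B (b i) (b j) else 0)
      + ∑ i, ∑ j, if i < j then b.repr x j * b.repr y i * B (b i) (b j) else 0 := by
    rw [hB]
    conv_rhs => rw [add_comm, Finset.sum_comm]
    simp only [← Finset.sum_add_distrib]
    refine Finset.sum_congr rfl fun i _ => Finset.sum_congr rfl fun j _ => ?_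
    rcases lt_trichotomy i j with h | h | h
    · simp [h, h.not_gt]
    · subst h; simp [halt]
    · simp [h, h.not_gt, symmB B halt (b i) (b j)]
  rw [hB2]
  simp only [← Finset.sum_add_distrib]
  refine Finset.sum_congr rfl fun i _ => Finset.sum_congr rfl fun j _ => ?_
  split_ifs
  · simp only [map_add, Finsupp.add_apply]; ring
  · simp

lemma cnt [Fintype V] (B : V →ₗ[ZMod 2] V →ₗ[ZMod 2] ZMod 2)
    (hnd : ∀ x : V, (∀ y : V, B x y = 0) → x = 0)
    (q : V → ZMod 2) (hq : ∀ x y : V, q (x + y) = q x + q y + B x y) (s : ℤ) :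
    Nat.card {q : V → ZMod 2 // (∀ x y : V, q (x + y) = q x + q y + B x y) ∧
        ∑ x : V, ((-1 : ℤ)) ^ (q x).val = s} =
    Nat.card {v : V // ∑ x : V, chi (q x + B v x) = s} := by
  symm
  have hinj : Function.Injective B := by
    rw [injective_iff_map_eq_zero]
    intro x hx
    exact hnd x fun y => by simp [hx]
  have hsurj : Function.Surjective B := by
    refine (LinearMap.injective_iff_surjective_of_finrank_eq_finrank ?_).1 hinj
    exact (Subspace.dual_finrank_eq (K := ZMod 2) (V := V)).symm
  refine Nat.card_congr (Equiv.ofBijective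
    (fun v => ⟨fun x => q x + B v.1 x, fun x y => ?_, v.2⟩) ⟨?_, ?_⟩)
  · simp only [hq, map_add]; ring
  · rintro ⟨v, hv⟩ ⟨w, hw⟩ h
    simp only [Subtype.mk.injEq] at h ⊢
    apply hinj
    ext x
    exact add_left_cancel (congrFun h x)
  · rintro ⟨p, hp, hs⟩
    let f : V →+ ZMod 2 := AddMonoidHom.mk' (fun x => p x - q x) (fun x y => by
      rw [hp, hq]; ring)
    obtain ⟨v, hv⟩ := hsurj (f.toZModLinearMap 2)
    have hv' : ∀ x, q x + B v x = p x := fun x => by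
      rw [hv]; simp [f]
    refine ⟨⟨v, ?_⟩, ?_⟩
    · simp only [hv']; exact hs
    · simp only [Subtype.mk.injEq]; exact funext hv'

lemma main [Fintype V] (m : ℕ) (hc : Fintype.card V = 2 ^ (2 * m))
    (a : V → ℤ) (ha : ∀ v, a v = 2 ^ m ∨ a v = -(2 ^ m)) (hs : ∑ v, a v = 2 ^ (2 * m)) :
    (Nat.card {v : V // a v = 2 ^ m} : ℝ) = (2 : ℝ) ^ ((m : ℤ) - 1) * (2 ^ m + 1) ∧
    (Nat.card {v : V // a v = -(2 ^ m)} : ℝ) = (2 : ℝ) ^ ((m : ℤ) - 1) * (2 ^ m - 1) := by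
  classical
  have hp : (0 : ℤ) < 2 ^ m := by positivity
  have e1 : (Nat.card {v : V // a v = 2 ^ m} : ℝ) = ∑ v, if a v = 2 ^ m then (1 : ℝ) else 0 := by
    simp [Fintype.card_subtype]
  have e2 : (Nat.card {v : V // a v = -(2 ^ m)} : ℝ) =
      ∑ v, if a v = -(2 ^ m) then (1 : ℝ) else 0 := by
    simp [Fintype.card_subtype]
  have hs' : ∑ v, (a v : ℝ) = 2 ^ (2 * m) := by exact_mod_cast hs
  have f1 : (Nat.card {v : V // a v = 2 ^ m} : ℝ) + Nat.card {v : V // a v = -(2 ^ m)} =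
      2 ^ (2 * m) := by
    rw [e1, e2, ← Finset.sum_add_distrib]
    have : ∀ v, ((if a v = 2 ^ m then (1 : ℝ) else 0) + if a v = -(2 ^ m) then (1 : ℝ) else 0)
        = 1 := by
      intro v
      rcases ha v with h | h
      · rw [if_pos h, if_neg (by omega)]; simp
      · rw [if_pos h, if_neg (by omega)]; simp
    simp [this, hc]
  have f2 : (2 : ℝ) ^ m * ((Nat.card {v : V // a v = 2 ^ m} : ℝ)
      - Nat.card {v : V // a v = -(2 ^ m)}) = 2 ^ (2 * m) := by
    rw [e1, e2, ← Finset.sum_sub_distrib, Finset.mul_sum, ← hs']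
    refine Finset.sum_congr rfl fun v _ => ?_
    rcases ha v with h | h
    · rw [if_pos h, if_neg (by omega), h]; simp
    · rw [if_pos h, if_neg (by omega), h]; simp
  have hp' : (2 : ℝ) ^ m ≠ 0 := by positivity
  have f3 : (Nat.card {v : V // a v = 2 ^ m} : ℝ)
      - Nat.card {v : V // a v = -(2 ^ m)} = 2 ^ m := by
    apply mul_left_cancel₀ hp'
    rw [f2]; ring
  have g : (2 : ℝ) ^ ((m : ℤ) - 1) = 2 ^ m / 2 := by
    rw [zpow_sub₀ (by norm_num)]; simp
  have g2 : (2 : ℝ) ^ (2 * m) = 2 ^ m * 2 ^ m := by ring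
  rw [g]
  rw [g2] at f1
  constructor <;> linarith

end Arf17

/-- Let `V` be a `2m`-dimensional vector space over `F₂` with a
nondegenerate alternating bilinear form `B`.  Every map `q : V → F₂` with
`q(x + y) = q(x) + q(y) + B(x, y)` satisfies `∑_{x ∈ V} (−1)^{q(x)} = ±2^m`; the number of
such `q` with sum `2^m` (Arf invariant `0`) is `2^{m−1}(2^m + 1)`, and the number with sum
`−2^m` (Arf invariant `1`) is `2^{m−1}(2^m − 1)`. -/
theorem statement17 (m : ℕ) (V : Type) [AddCommGroup V] [Module (ZMod 2) V] [Fintype V]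
    (hdim : Module.finrank (ZMod 2) V = 2 * m)
    (B : V →ₗ[ZMod 2] V →ₗ[ZMod 2] ZMod 2)
    (halt : ∀ x : V, B x x = 0)
    (hnd : ∀ x : V, (∀ y : V, B x y = 0) → x = 0) :
    (∀ q : V → ZMod 2, (∀ x y : V, q (x + y) = q x + q y + B x y) →
      (∑ x : V, ((-1 : ℤ)) ^ (q x).val = 2 ^ m ∨
       ∑ x : V, ((-1 : ℤ)) ^ (q x).val = -(2 ^ m))) ∧
    (Nat.card {q : V → ZMod 2 // (∀ x y : V, q (x + y) = q x + q y + B x y) ∧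
        ∑ x : V, ((-1 : ℤ)) ^ (q x).val = 2 ^ m} : ℝ) =
      (2 : ℝ) ^ ((m : ℤ) - 1) * (2 ^ m + 1) ∧
    (Nat.card {q : V → ZMod 2 // (∀ x y : V, q (x + y) = q x + q y + B x y) ∧
        ∑ x : V, ((-1 : ℤ)) ^ (q x).val = -(2 ^ m)} : ℝ) =
      (2 : ℝ) ^ ((m : ℤ) - 1) * (2 ^ m - 1) := by
  classical
  have hc : Fintype.card V = 2 ^ (2 * m) := by
    rw [Module.card_eq_pow_finrank (K := ZMod 2) (V := V), hdim, ZMod.card]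
  have key : ∀ q : V → ZMod 2, (∀ x y : V, q (x + y) = q x + q y + B x y) →
      (∑ x : V, Arf17.chi (q x) = 2 ^ m ∨ ∑ x : V, Arf17.chi (q x) = -(2 ^ m)) := by
    intro q hq
    have h := Arf17.sq B halt hnd q hq
    apply sq_eq_sq_iff_eq_or_eq_neg.1
    rw [h, hc]; push_cast; ring
  obtain ⟨q, hq⟩ := Arf17.exq B halt
  have q0 : q 0 = 0 := by simpa using hq 0 0
  refine ⟨key, ?_⟩
  rw [Arf17.cnt B hnd q hq, Arf17.cnt B hnd q hq]
  apply Arf17.main m hc (fun v => ∑ x : V, Arf17.chi (q x + B v x))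
  · intro v
    apply key
    intro x y
    simp only [hq, map_add]; ring
  · simp only [Arf17.chi_add]
    rw [Finset.sum_comm]
    simp only [← Finset.mul_sum, Arf17.charsum B halt hnd]
    simp [q0, Arf17.chi_zero, hc]
end

section
/- Let g ≥ 2 be an even natural number and let Γ_{2g} := { x ∈ ℝ^{2g} : 2x_j ∈ ℤ for all j; x_j − x_k ∈ ℤ for all j, k; ∑_j x_j ∈ 2ℤ }, with the standard inner product ⟪x, y⟫ = ∑_j x_j y_j of ℝ^{2g}. Then: (a) ⟪x, y⟫ ∈ ℤ for all x, y ∈ Γ_{2g}, and Γ_{2g} is unimodular, i.e. it equals its dual: { y ∈ ℝ^{2g} : ⟪x, y⟫ ∈ ℤ for all x ∈ Γ_{2g} } = Γ_{2g}; (b) Γ_{2g} is even (⟪x, x⟫ ∈ 2ℤ for all x ∈ Γ_{2g}) if and only if 4 divides g; (c) the ℝ-linear map I : ℝ^{2g} → ℝ^{2g} defined on the standard basis by I(e_{2j−1}) = e_{2j} and I(e_{2j}) = −e_{2j−1} for 1 ≤ j ≤ g satisfies I² = −id, preserves the inner product, and maps Γ_{2g} onto itself, so that Γ_{2g} is a unimodular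 Gaussian lattice. -/
/-- The lattice `Γ_{2g} ⊂ ℝ^{2g}`: vectors whose coordinates are half-integers, congruent to
each other modulo `ℤ`, with sum in `2ℤ`. -/
def GammaLattice (g : ℕ) : Set (Fin (2 * g) → ℝ) :=
  {x | (∀ j, ∃ n : ℤ, 2 * x j = (n : ℝ)) ∧
       (∀ j k, ∃ n : ℤ, x j - x k = (n : ℝ)) ∧
       (∃ n : ℤ, ∑ j, x j = 2 * (n : ℝ))}

/-- The standard inner product on `ℝ^{2g}`. -/
def dotProd (g : ℕ) (x y : Fin (2 * g) → ℝ) : ℝ := ∑ j, x j * y j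

/-- The `ℝ`-linear map `I : ℝ^{2g} → ℝ^{2g}` given on the standard basis (`1`-indexed) by
`I(e_{2j−1}) = e_{2j}` and `I(e_{2j}) = −e_{2j−1}`; in (`0`-indexed) coordinates,
`(I x)_k = −x_{k+1}` for `k` even and `(I x)_k = x_{k−1}` for `k` odd. -/
def Ifun (g : ℕ) (x : Fin (2 * g) → ℝ) : Fin (2 * g) → ℝ :=
  fun k =>
    if _h : k.val % 2 = 0 then -(x ⟨k.val + 1, by have := k.isLt; omega⟩)
    else x ⟨k.val - 1, by have := k.isLt; omega⟩

theorem gamma_iff (g : ℕ) (hg : 2 ≤ g) (h : ℕ) (hh : g = h + h) (x : Fin (2 * g) → ℝ) :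
    x ∈ GammaLattice g ↔ ∃ (a : ℤ) (n : Fin (2 * g) → ℤ) (m : ℤ),
      (∀ j, x j = (a : ℝ) / 2 + n j) ∧ ∑ j, n j = 2 * m := by
  have key : ∀ (a : ℤ) (n : Fin (2 * g) → ℤ), (∀ j, x j = (a : ℝ) / 2 + n j) →
      ∑ j, x j = 2 * (h * a : ℝ) + ((∑ j, n j : ℤ) : ℝ) := by
    intro a n hx
    simp only [hx, Finset.sum_add_distrib, Finset.sum_const, Finset.card_univ, Fintype.card_fin]
    subst hh
    push_cast
    simp
    ring
  constructor
  · rintro ⟨h1, h2, m, h3⟩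
    obtain ⟨a, ha⟩ := h1 ⟨0, by omega⟩
    choose n hn using fun j => h2 j ⟨0, by omega⟩
    have hx : ∀ j, x j = (a : ℝ) / 2 + n j := by
      intro j
      have := hn j
      linarith
    refine ⟨a, n, m - h * a, hx, ?_⟩
    have := key a n hx
    rw [h3] at this
    have h4 : ((∑ j, n j : ℤ) : ℝ) = ((2 * (m - h * a) : ℤ) : ℝ) := by
      push_cast at this ⊢
      linarith
    exact_mod_cast h4
  · rintro ⟨a, n, m, hx, hs⟩
    refine ⟨fun j => ⟨a + 2 * n j, ?_⟩, fun j k => ⟨n j - n k, ?_⟩, ⟨h * a + m, ?_⟩⟩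
    · rw [hx]; push_cast; ring
    · rw [hx, hx]; push_cast; ring
    · rw [key a n hx, hs]; push_cast; ring

theorem dot_formula (g : ℕ) (h : ℕ) (hh : g = h + h) (x y : Fin (2 * g) → ℝ)
    (a b : ℤ) (n p : Fin (2 * g) → ℤ) (m q : ℤ)
    (hx : ∀ j, x j = (a : ℝ) / 2 + n j) (hn : ∑ j, n j = 2 * m)
    (hy : ∀ j, y j = (b : ℝ) / 2 + p j) (hp : ∑ j, p j = 2 * q) :
    dotProd g x y = ((h * a * b + a * q + b * m + ∑ j, n j * p j : ℤ) : ℝ) := by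
  have hn' : ∑ j, (n j : ℝ) = 2 * m := by exact_mod_cast hn
  have hp' : ∑ j, (p j : ℝ) = 2 * q := by exact_mod_cast hp
  have e : ∀ j, x j * y j = (a : ℝ) * b / 4 + (a : ℝ) / 2 * p j + (b : ℝ) / 2 * n j
      + (n j : ℝ) * p j := by
    intro j; rw [hx, hy]; ring
  unfold dotProd
  simp only [e, Finset.sum_add_distrib, ← Finset.mul_sum, hn', hp', Finset.sum_const,
    Finset.card_univ, Fintype.card_fin]
  subst hh
  push_cast
  simp
  ring

/-- the partner index -/
def sig (g : ℕ) (k : Fin (2 * g)) : Fin (2 * g) :=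
  if _h : k.val % 2 = 0 then ⟨k.val + 1, by have := k.isLt; omega⟩
  else ⟨k.val - 1, by have := k.isLt; omega⟩

theorem sig_inv (g : ℕ) : Function.Involutive (sig g) := by
  intro k
  apply Fin.ext
  unfold sig
  by_cases h : k.val % 2 = 0
  · have : ¬ (k.val + 1) % 2 = 0 := by omega
    simp [h, this]
  · have : (k.val - 1) % 2 = 0 := by omega
    simp [h, this]
    omega

theorem sig_mod (g : ℕ) (k : Fin (2 * g)) : (sig g k).val % 2 = 0 ↔ ¬ k.val % 2 = 0 := by
  unfold sig
  split_ifs with h <;> simp <;> omega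

theorem Ifun_eq (g : ℕ) (x : Fin (2 * g) → ℝ) (k : Fin (2 * g)) :
    Ifun g x k = if k.val % 2 = 0 then - x (sig g k) else x (sig g k) := by
  unfold Ifun sig
  split_ifs with h <;> rfl

theorem sum_sig {M : Type*} [AddCommMonoid M] (g : ℕ) (f : Fin (2 * g) → M) :
    ∑ k, f (sig g k) = ∑ k, f k :=
  (sig_inv g).bijective.sum_comp f

theorem Ifun_sq (g : ℕ) (x : Fin (2 * g) → ℝ) : Ifun g (Ifun g x) = -x := by
  funext k
  have := sig_mod g k
  have h2 : sig g (sig g k) = k := sig_inv g k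
  rw [Ifun_eq, Ifun_eq, h2]
  by_cases h : k.val % 2 = 0 <;> simp [h, this]

theorem count_even (g : ℕ) :
    ∑ k : Fin (2 * g), (if k.val % 2 = 0 then (1 : ℤ) else 0) = g := by
  have h1 := sum_sig g (fun k => if k.val % 2 = 0 then (1 : ℤ) else 0)
  have h2 : ∑ k : Fin (2 * g), ((if k.val % 2 = 0 then (1 : ℤ) else 0) +
      (if (sig g k).val % 2 = 0 then (1 : ℤ) else 0)) = 2 * g := by
    have : ∀ k : Fin (2 * g), ((if k.val % 2 = 0 then (1 : ℤ) else 0) +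
      (if (sig g k).val % 2 = 0 then (1 : ℤ) else 0)) = 1 := by
      intro k
      simp only [sig_mod]
      split_ifs <;> simp
    simp [this]
  rw [Finset.sum_add_distrib] at h2
  linarith

theorem Ifun_mem (g : ℕ) (hg : 2 ≤ g) (h : ℕ) (hh : g = h + h) (x : Fin (2 * g) → ℝ)
    (hx : x ∈ GammaLattice g) : Ifun g x ∈ GammaLattice g := by
  rw [gamma_iff g hg h hh] at hx ⊢
  obtain ⟨a, n, m, hx, hs⟩ := hx
  refine ⟨a, fun k => n (sig g k) - a * (if k.val % 2 = 0 then 1 else 0)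
    - 2 * (if k.val % 2 = 0 then n (sig g k) else 0),
    m - a * h - ∑ k : Fin (2 * g), (if k.val % 2 = 0 then n (sig g k) else 0), ?_, ?_⟩
  · intro j
    rw [Ifun_eq, hx]
    by_cases e : j.val % 2 = 0 <;> simp only [e, if_true, if_false] <;> push_cast <;> ring
  · rw [Finset.sum_sub_distrib, Finset.sum_sub_distrib, ← Finset.mul_sum, ← Finset.mul_sum,
      count_even, sum_sig g n, hs]
    have : (g : ℤ) = h + h := by exact_mod_cast hh
    rw [this]
    ring

/-- For even `g ≥ 2`: (a) the inner product is integral on `Γ_{2g}` and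
`Γ_{2g}` equals its dual lattice (unimodularity); (b) `Γ_{2g}` is even iff `4 ∣ g`;
(c) the map `I` is `ℝ`-linear, satisfies `I² = −id`, preserves the inner product, and maps
`Γ_{2g}` onto itself, so that `Γ_{2g}` is a unimodular Gaussian lattice. -/
theorem statement19 (g : ℕ) (hg : 2 ≤ g) (hgeven : Even g) :
    -- (a)
    ((∀ x ∈ GammaLattice g, ∀ y ∈ GammaLattice g, ∃ n : ℤ, dotProd g x y = (n : ℝ)) ∧
     {y | ∀ x ∈ GammaLattice g, ∃ n : ℤ, dotProd g x y = (n : ℝ)} = GammaLattice g) ∧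
    -- (b)
    ((∀ x ∈ GammaLattice g, ∃ n : ℤ, dotProd g x x = 2 * (n : ℝ)) ↔ 4 ∣ g) ∧
    -- (c)
    (IsLinearMap ℝ (Ifun g) ∧
     (∀ x, Ifun g (Ifun g x) = -x) ∧
     (∀ x y, dotProd g (Ifun g x) (Ifun g y) = dotProd g x y) ∧
     Ifun g '' GammaLattice g = GammaLattice g) := by
  obtain ⟨h, hh⟩ := hgeven
  have G := gamma_iff g hg h hh
  have A : ∀ x ∈ GammaLattice g, ∀ y ∈ GammaLattice g, ∃ n : ℤ, dotProd g x y = (n : ℝ) := by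
    intro x hx y hy
    obtain ⟨a, n, m, hx, hn⟩ := (G x).1 hx
    obtain ⟨b, p, q, hy, hp⟩ := (G y).1 hy
    exact ⟨_, dot_formula g h hh x y a b n p m q hx hn hy hp⟩
  have halfmem : (fun _ => 1 / 2 : Fin (2 * g) → ℝ) ∈ GammaLattice g :=
    (G _).2 ⟨1, fun _ => 0, 0, by simp, by simp⟩
  refine ⟨⟨A, ?_⟩, ?_, ?_, Ifun_sq g, ?_, ?_⟩
  · ext y
    refine ⟨fun H => ⟨fun j => ?_, fun j k => ?_, ?_⟩, fun hy x hx => A x hx y hy⟩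
    · obtain ⟨n, hn⟩ := H (Pi.single j 2) ((G _).2 ⟨0, Pi.single j 2, 1, by
        intro i
        by_cases e : i = j
        · subst e; simp
        · simp [e], by simp⟩)
      refine ⟨n, ?_⟩
      rw [← hn]
      simp [dotProd, Pi.single_apply]
    · obtain ⟨n, hn⟩ := H (Pi.single j 1 - Pi.single k 1)
        ((G _).2 ⟨0, Pi.single j 1 - Pi.single k 1, 0, by
        intro i
        simp [Pi.single_apply], by simp⟩)
      refine ⟨n, ?_⟩
      rw [← hn]
      simp [dotProd, Pi.single_apply, sub_mul]
    · obtain ⟨n, hn⟩ := H _ halfmem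
      refine ⟨n, ?_⟩
      rw [← hn]
      simp only [dotProd, ← Finset.mul_sum]
      ring
  · constructor
    · intro H
      obtain ⟨n, hn⟩ := H _ halfmem
      have : dotProd g (fun _ => 1 / 2) (fun _ => 1 / 2) = (h : ℝ) := by
        have := dot_formula g h hh (fun _ => 1 / 2) (fun _ => 1 / 2) 1 1 (fun _ => 0) (fun _ => 0)
          0 0 (by simp) (by simp) (by simp) (by simp)
        rw [this]; simp
      rw [this] at hn
      have h2 : (h : ℤ) = 2 * n := by exact_mod_cast hn
      omega
    · rintro ⟨c, hc⟩ x hx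
      obtain ⟨a, n, m, hx, hn⟩ := (G x).1 hx
      have hd := dot_formula g h hh x x a a n n m m hx hn hx hn
      have h2 : (h : ℤ) = 2 * c := by omega
      have h3 : (2 : ℤ) ∣ ∑ j, n j * n j := by
        have h4 : (2 : ℤ) ∣ ∑ j, (n j * n j - n j) := by
          apply Finset.dvd_sum
          intro j _
          have := Int.even_mul_pred_self (n j)
          rw [mul_sub, mul_one] at this
          exact this.two_dvd
        rw [Finset.sum_sub_distrib, hn] at h4
        omega
      obtain ⟨r, hr⟩ := h3
      refine ⟨c * a * a + a * m + r, ?_⟩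
      rw [hd, hr, h2]
      push_cast
      ring
  · constructor
    · intro x y
      funext k
      simp only [Ifun_eq, Pi.add_apply]
      split_ifs <;> ring
    · intro c x
      funext k
      simp only [Ifun_eq, Pi.smul_apply, smul_eq_mul]
      split_ifs <;> ring
  · intro x y
    unfold dotProd
    rw [← sum_sig g (fun k => x k * y k)]
    apply Finset.sum_congr rfl
    intro k _
    simp only [Ifun_eq]
    split_ifs <;> ring
  · ext y
    constructor
    · rintro ⟨x, hx, rfl⟩
      exact Ifun_mem g hg h hh x hx
    · intro hy
      refine ⟨Ifun g (Ifun g (Ifun g y)), ?_, ?_⟩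
      · exact Ifun_mem g hg h hh _ (Ifun_mem g hg h hh _ (Ifun_mem g hg h hh _ hy))
      · rw [Ifun_sq, Ifun_sq, neg_neg]
end
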